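/- arXiv:1701.06798 — 2 statements merged into one kernel-verified Lean document; each statement's English description precedes it below -/
import Mathlib

section
/- Let K be a quadratic separable field extension of F with Galois group {id, σ}, and let K₁₀,K := {X ∈ K₁₀ ⊗_F K : (τ⊗σ)(X) = X}, an F-superalgebra. If A is a twisted form of K₁₀ over F such that A is not isomorphic to K₁₀ as an F-superalgebra and A ⊗_F K ≅ K₁₀ ⊗_F K as K-superalgebras, then A is isomorphic to K₁₀,K as F-superalgebras. -/
open scoped TensorProduct
noncomputable section
namespace Kac

/-! ### Superalgebra isomorphisms and automorphisms -/

@[ext]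
structure SuperIso (S A B : Type) [CommRing S]
    [AddCommGroup A] [Module S A] [Mul A]
    [AddCommGroup B] [Module S B] [Mul B]
    (evA odA : Submodule S A) (evB odB : Submodule S B) : Type where
  e : A ≃ₗ[S] B
  map_mul' : ∀ x y : A, e (x * y) = e x * e y
  map_even : evA.map e.toLinearMap = evB
  map_odd : odA.map e.toLinearMap = odB

abbrev SuperAut (S A : Type) [CommRing S] [AddCommGroup A] [Module S A] [Mul A]
    (ev od : Submodule S A) := SuperIso S A A ev od ev od

namespace SuperAut

variable {S A : Type} [CommRing S] [AddCommGroup A] [Module S A] [Mul A]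
variable {ev od : Submodule S A}

private lemma map_symm {f : A ≃ₗ[S] A} {p : Submodule S A}
    (h : p.map f.toLinearMap = p) : p.map f.symm.toLinearMap = p := by
  have h2 : f.symm.toLinearMap.comp f.toLinearMap = LinearMap.id := by
    ext x; simp
  calc p.map f.symm.toLinearMap
      = (p.map f.toLinearMap).map f.symm.toLinearMap := by rw [h]
    _ = p.map (f.symm.toLinearMap.comp f.toLinearMap) := by
        rw [Submodule.map_comp]
    _ = p := by rw [h2, Submodule.map_id]

instance : Group (SuperAut S A ev od) where
  one := ⟨LinearEquiv.refl S A, fun _ _ => rfl, Submodule.map_id _, Submodule.map_id _⟩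
  mul f g := ⟨g.e.trans f.e,
    fun x y => by simp [LinearEquiv.trans_apply, g.map_mul', f.map_mul'],
    by rw [LinearEquiv.coe_trans, Submodule.map_comp, g.map_even, f.map_even],
    by rw [LinearEquiv.coe_trans, Submodule.map_comp, g.map_odd, f.map_odd]⟩
  inv f := ⟨f.e.symm,
    fun x y => f.e.injective <| by simp [f.map_mul'],
    map_symm f.map_even, map_symm f.map_odd⟩
  mul_assoc f g h := by apply SuperIso.ext; apply LinearEquiv.ext; intro x; rfl
  one_mul f := by apply SuperIso.ext; apply LinearEquiv.ext; intro x; rfl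
  mul_one f := by apply SuperIso.ext; apply LinearEquiv.ext; intro x; rfl
  inv_mul_cancel f := by
    apply SuperIso.ext; apply LinearEquiv.ext; intro x
    exact f.e.symm_apply_apply x

end SuperAut

/-- The predicate that a pair of submodules `ev`, `od` makes a non-unital
(possibly non-associative) algebra `B` into a superalgebra. -/
def IsSuperalgebra (S B : Type) [CommRing S] [NonUnitalNonAssocRing B] [Module S B]
    (ev od : Submodule S B) : Prop :=
  ev ⊔ od = ⊤ ∧ ev ⊓ od = ⊥ ∧
  (∀ x ∈ ev, ∀ y ∈ ev, x * y ∈ ev) ∧ (∀ x ∈ ev, ∀ y ∈ od, x * y ∈ od) ∧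
  (∀ x ∈ od, ∀ y ∈ ev, x * y ∈ od) ∧ (∀ x ∈ od, ∀ y ∈ od, x * y ∈ ev)

/-! ### Submodules given by vanishing of coordinates -/

def stdSub (S R : Type) [Semiring S] [AddCommGroup R] [Module S R] (n : ℕ)
    (s : Set (Fin n)) : Submodule S (Fin n → R) where
  carrier := {x | ∀ i, i ∉ s → x i = 0}
  add_mem' := fun {a b} ha hb i hi => by
    simp [Pi.add_apply, ha i hi, hb i hi]
  zero_mem' := fun i _ => rfl
  smul_mem' := fun c x hx i hi => by
    simp [Pi.smul_apply, hx i hi]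

/-! ### Gradings by abelian groups -/

section Gradings

variable {G H S A : Type} [CommGroup G] [CommGroup H] [CommRing S]
  [AddCommGroup A] [Module S A] [Mul A]

/-- `comp` is a `G`-grading of the superalgebra `(A, ev, od)`. -/
def IsSuperGrading (ev od : Submodule S A) (comp : G → Submodule S A) : Prop :=
  (letI := Classical.decEq G; DirectSum.IsInternal comp) ∧
  (∀ (g h : G) (x y : A), x ∈ comp g → y ∈ comp h → x * y ∈ comp (g * h)) ∧
  (∀ g, comp g = (comp g ⊓ ev) ⊔ (comp g ⊓ od))

/-- The grading with homogeneous elements `w i` of degrees `d i`. -/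
def gradingOf (S : Type) {A G : Type} [CommRing S] [AddCommGroup A] [Module S A]
    [CommGroup G] {n : ℕ} (w : Fin n → A) (d : Fin n → G) : G → Submodule S A :=
  fun g => Submodule.span S (w '' {i | d i = g})

/-- Isomorphism of two `G`-gradings on a superalgebra. -/
def GradIso (ev od : Submodule S A) (comp comp' : G → Submodule S A) : Prop :=
  ∃ φ : SuperAut S A ev od, ∀ g, (comp g).map φ.e.toLinearMap = comp' g

/-- `Δ` refines `Γ`. -/
def Refines (Δ : H → Submodule S A) (Γ : G → Submodule S A) : Prop :=
  ∀ h, Δ h ≠ ⊥ → ∃ g, Δ h ≤ Γ g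

/-- Equivalence of a `G`-grading and an `H`-grading on a superalgebra. -/
def GradEquiv (ev od : Submodule S A) (Γ : G → Submodule S A)
    (Δ : H → Submodule S A) : Prop :=
  ∃ φ : SuperAut S A ev od, ∃ α : {g : G // Γ g ≠ ⊥} → {h : H // Δ h ≠ ⊥},
    Function.Bijective α ∧
    ∀ g : {g : G // Γ g ≠ ⊥}, (Γ g.1).map φ.e.toLinearMap = Δ (α g).1

/-- A grading is fine if any grading refining it has the same nonzero
homogeneous components. -/
def IsFine (ev od : Submodule S A) (Γ : G → Submodule S A) : Prop :=
  ∀ (H : Type) (_ : CommGroup H) (Δ : H → Submodule S A),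
    IsSuperGrading ev od Δ → Refines Δ Γ →
      {p : Submodule S A | p ≠ ⊥ ∧ ∃ h, Δ h = p} =
      {p : Submodule S A | p ≠ ⊥ ∧ ∃ g, Γ g = p}

end Gradings

/-! ### SL₂ and the semidirect product with C₂ -/

abbrev SL2 (R : Type) [CommRing R] := Matrix.SpecialLinearGroup (Fin 2) R

def swapAut (M : Type) [Monoid M] : MulAut (M × M) := MulEquiv.prodComm

lemma swapAut_sq (M : Type) [Monoid M] : swapAut M * swapAut M = 1 :=
  MulEquiv.ext fun _ => rfl

/-- The action of `C₂ = Multiplicative (ZMod 2)` on `M × M` by swapping the factors. -/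
def swapHom (M : Type) [Group M] : Multiplicative (ZMod 2) →* MulAut (M × M) :=
  MonoidHom.mk' (fun c => if c.toAdd = 0 then 1 else swapAut M) (by
    intro a b
    have key : ∀ c : Multiplicative (ZMod 2),
        c = Multiplicative.ofAdd 0 ∨ c = Multiplicative.ofAdd 1 := by decide
    rcases key a with rfl | rfl <;> rcases key b with rfl | rfl <;>
      simp [← ofAdd_add, swapAut_sq] <;> exact fun h => absurd (by decide) h)

end Kac
/-! ### The (base-changed) Kaplansky superalgebra `K₃ ⊗ R` -/

namespace Kac

section Algebras

variable (F : Type) [Field F] (R : Type) [CommRing R] [Algebra F R]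

/-- Coordinates: `0 ↦ a`, `1 ↦ u`, `2 ↦ v`. -/
def K3A (F : Type) [Field F] (R : Type) [CommRing R] [Algebra F R] : Type := Fin 3 → R

instance : AddCommGroup (K3A F R) := Pi.addCommGroup
instance (S : Type) [Semiring S] [Module S R] : Module S (K3A F R) := Pi.module _ _ _

namespace K3A
variable {F R}

def mulFun (x y : K3A F R) : K3A F R := fun i =>
  match i with
  | ⟨0, _⟩ => x 0 * y 0 + (x 1 * y 2 - x 2 * y 1)
  | ⟨1, _⟩ => algebraMap F R 2⁻¹ * (x 0 * y 1 + y 0 * x 1)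
  | ⟨2, _⟩ => algebraMap F R 2⁻¹ * (x 0 * y 2 + y 0 * x 2)

instance : Mul (K3A F R) := ⟨mulFun⟩

lemma mul_def (x y : K3A F R) : x * y = mulFun x y := rfl

@[simp] lemma add_apply (x y : K3A F R) (i : Fin 3) : (x + y) i = x i + y i := rfl
@[simp] lemma sub_apply (x y : K3A F R) (i : Fin 3) : (x - y) i = x i - y i := rfl
@[simp] lemma neg_apply (x : K3A F R) (i : Fin 3) : (-x) i = -(x i) := rfl
@[simp] lemma zero_apply (i : Fin 3) : (0 : K3A F R) i = 0 := rfl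
@[simp] lemma smul_apply (S : Type) [Semiring S] [Module S R] (c : S) (x : K3A F R) (i : Fin 3) :
    (c • x) i = c • (x i) := rfl

variable (F R)

/-- The even part `R·a`. -/
def even (S : Type) [Semiring S] [Module S R] : Submodule S (K3A F R) := stdSub S R 3 {0}
/-- The odd part `W ⊗ R`. -/
def odd (S : Type) [Semiring S] [Module S R] : Submodule S (K3A F R) := stdSub S R 3 {1, 2}

/-- The element `a`. -/
def aE : K3A F R := ![1, 0, 0]
/-- The element of `W ⊗ R` with coordinates `w` in the symplectic basis `{u, v}`. -/
def wE (w : Fin 2 → R) : K3A F R := ![0, w 0, w 1]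

end K3A

/-- `J(W) ⊗ R`; coordinates: `0 ↦ 1`, `1 ↦ u`, `2 ↦ v`. -/
def JW1A (R : Type) [CommRing R] : Type := Fin 3 → R

instance : AddCommGroup (JW1A R) := Pi.addCommGroup
instance (S : Type) [Semiring S] [Module S R] : Module S (JW1A R) := Pi.module _ _ _

namespace JW1A
variable {R}

def mulFun (x y : JW1A R) : JW1A R := fun i =>
  match i with
  | ⟨0, _⟩ => x 0 * y 0 + (x 1 * y 2 - x 2 * y 1)
  | ⟨1, _⟩ => x 0 * y 1 + y 0 * x 1
  | ⟨2, _⟩ => x 0 * y 2 + y 0 * x 2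

instance : Mul (JW1A R) := ⟨mulFun⟩

lemma mul_def (x y : JW1A R) : x * y = mulFun x y := rfl

@[simp] lemma add_apply (x y : JW1A R) (i : Fin 3) : (x + y) i = x i + y i := rfl
@[simp] lemma sub_apply (x y : JW1A R) (i : Fin 3) : (x - y) i = x i - y i := rfl
@[simp] lemma neg_apply (x : JW1A R) (i : Fin 3) : (-x) i = -(x i) := rfl
@[simp] lemma zero_apply (i : Fin 3) : (0 : JW1A R) i = 0 := rfl
@[simp] lemma smul_apply (S : Type) [Semiring S] [Module S R] (c : S) (x : JW1A R) (i : Fin 3) :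
    (c • x) i = c • (x i) := rfl

variable (R)

def even (S : Type) [Semiring S] [Module S R] : Submodule S (JW1A R) := stdSub S R 3 {0}
def odd (S : Type) [Semiring S] [Module S R] : Submodule S (JW1A R) := stdSub S R 3 {1, 2}

def oneE : JW1A R := ![1, 0, 0]
def wE (w : Fin 2 → R) : JW1A R := ![0, w 0, w 1]

end JW1A

/-- `(K₃ × K₃) ⊗ R`; coordinates `0,1,2` for the first copy (`a,u,v`),
`3,4,5` for the second copy. -/
def K33A (F : Type) [Field F] (R : Type) [CommRing R] [Algebra F R] : Type := Fin 6 → R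

instance : AddCommGroup (K33A F R) := Pi.addCommGroup
instance (S : Type) [Semiring S] [Module S R] : Module S (K33A F R) := Pi.module _ _ _

namespace K33A
variable {F R}

def mulFun (x y : K33A F R) : K33A F R := fun i =>
  match i with
  | ⟨0, _⟩ => x 0 * y 0 + (x 1 * y 2 - x 2 * y 1)
  | ⟨1, _⟩ => algebraMap F R 2⁻¹ * (x 0 * y 1 + y 0 * x 1)
  | ⟨2, _⟩ => algebraMap F R 2⁻¹ * (x 0 * y 2 + y 0 * x 2)
  | ⟨3, _⟩ => x 3 * y 3 + (x 4 * y 5 - x 5 * y 4)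
  | ⟨4, _⟩ => algebraMap F R 2⁻¹ * (x 3 * y 4 + y 3 * x 4)
  | ⟨5, _⟩ => algebraMap F R 2⁻¹ * (x 3 * y 5 + y 3 * x 5)

instance : Mul (K33A F R) := ⟨mulFun⟩

lemma mul_def (x y : K33A F R) : x * y = mulFun x y := rfl

@[simp] lemma add_apply (x y : K33A F R) (i : Fin 6) : (x + y) i = x i + y i := rfl
@[simp] lemma sub_apply (x y : K33A F R) (i : Fin 6) : (x - y) i = x i - y i := rfl
@[simp] lemma neg_apply (x : K33A F R) (i : Fin 6) : (-x) i = -(x i) := rfl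
@[simp] lemma zero_apply (i : Fin 6) : (0 : K33A F R) i = 0 := rfl
@[simp] lemma smul_apply (S : Type) [Semiring S] [Module S R] (c : S) (x : K33A F R) (i : Fin 6) :
    (c • x) i = c • (x i) := rfl

variable (F R)

def even (S : Type) [Semiring S] [Module S R] : Submodule S (K33A F R) := stdSub S R 6 {0, 3}
def odd (S : Type) [Semiring S] [Module S R] : Submodule S (K33A F R) := stdSub S R 6 {1, 2, 4, 5}

/-- The element `(a, 0)`. -/
def aLeft : K33A F R := ![1, 0, 0, 0, 0, 0]
/-- The element `(0, a)`. -/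
def aRight : K33A F R := ![0, 0, 0, 1, 0, 0]
/-- The element `(v, w)` of the odd part, `v, w ∈ W ⊗ R`. -/
def oddE (w w' : Fin 2 → R) : K33A F R := ![0, w 0, w 1, 0, w' 0, w' 1]
/-- The exchange automorphism `(x, y) ↦ (y, x)`. -/
def swapFun (x : K33A F R) : K33A F R := fun i =>
  match i with
  | ⟨0, _⟩ => x 3
  | ⟨1, _⟩ => x 4
  | ⟨2, _⟩ => x 5
  | ⟨3, _⟩ => x 0
  | ⟨4, _⟩ => x 1
  | ⟨5, _⟩ => x 2

end K33A

/-- `(J(W) × J(W)) ⊗ R`. -/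
def JW2A (R : Type) [CommRing R] : Type := Fin 6 → R

instance : AddCommGroup (JW2A R) := Pi.addCommGroup
instance (S : Type) [Semiring S] [Module S R] : Module S (JW2A R) := Pi.module _ _ _

namespace JW2A
variable {R}

def mulFun (x y : JW2A R) : JW2A R := fun i =>
  match i with
  | ⟨0, _⟩ => x 0 * y 0 + (x 1 * y 2 - x 2 * y 1)
  | ⟨1, _⟩ => x 0 * y 1 + y 0 * x 1
  | ⟨2, _⟩ => x 0 * y 2 + y 0 * x 2
  | ⟨3, _⟩ => x 3 * y 3 + (x 4 * y 5 - x 5 * y 4)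
  | ⟨4, _⟩ => x 3 * y 4 + y 3 * x 4
  | ⟨5, _⟩ => x 3 * y 5 + y 3 * x 5

instance : Mul (JW2A R) := ⟨mulFun⟩

lemma mul_def (x y : JW2A R) : x * y = mulFun x y := rfl

@[simp] lemma add_apply (x y : JW2A R) (i : Fin 6) : (x + y) i = x i + y i := rfl
@[simp] lemma sub_apply (x y : JW2A R) (i : Fin 6) : (x - y) i = x i - y i := rfl
@[simp] lemma neg_apply (x : JW2A R) (i : Fin 6) : (-x) i = -(x i) := rfl
@[simp] lemma zero_apply (i : Fin 6) : (0 : JW2A R) i = 0 := rfl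
@[simp] lemma smul_apply (S : Type) [Semiring S] [Module S R] (c : S) (x : JW2A R) (i : Fin 6) :
    (c • x) i = c • (x i) := rfl

variable (R)

def even (S : Type) [Semiring S] [Module S R] : Submodule S (JW2A R) := stdSub S R 6 {0, 3}
def odd (S : Type) [Semiring S] [Module S R] : Submodule S (JW2A R) := stdSub S R 6 {1, 2, 4, 5}

/-- The element `(1, 0)`. -/
def oneLeft : JW2A R := ![1, 0, 0, 0, 0, 0]
/-- The element `(0, 1)`. -/
def oneRight : JW2A R := ![0, 0, 0, 1, 0, 0]
def oddE (w w' : Fin 2 → R) : JW2A R := ![0, w 0, w 1, 0, w' 0, w' 1]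
def swapFun (x : JW2A R) : JW2A R := fun i =>
  match i with
  | ⟨0, _⟩ => x 3
  | ⟨1, _⟩ => x 4
  | ⟨2, _⟩ => x 5
  | ⟨3, _⟩ => x 0
  | ⟨4, _⟩ => x 1
  | ⟨5, _⟩ => x 2

end JW2A

/-- Kac's superalgebra `K₁₀ ⊗ R`.  CoordinatesL `0 ↦ 1`, `1 ↦ a⊗a`,
`2 ↦ u⊗u`, `3 ↦ u⊗v`, `4 ↦ v⊗u`, `5 ↦ v⊗v`, `6 ↦ u⊗a`, `7 ↦ v⊗a`,
`8 ↦ a⊗u`, `9 ↦ a⊗v`. -/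
def K10A (F : Type) [Field F] (R : Type) [CommRing R] [Algebra F R] : Type := Fin 10 → R

instance : AddCommGroup (K10A F R) := Pi.addCommGroup
instance (S : Type) [Semiring S] [Module S R] : Module S (K10A F R) := Pi.module _ _ _

namespace K10A
variable {F R}

def mulFun (x y : K10A F R) : K10A F R := fun i =>
  match i with
  | ⟨0, _⟩ => x 0 * y 0 - algebraMap F R (3/16) * (x 1 * y 1)
      + algebraMap F R (3/4) * (x 2 * y 5 + x 5 * y 2 - x 3 * y 4 - x 4 * y 3)
      - algebraMap F R (3/8) * (x 6 * y 7 - x 7 * y 6 + x 8 * y 9 - x 9 * y 8)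
  | ⟨1, _⟩ => x 0 * y 1 + x 1 * y 0 + x 1 * y 1
      - (x 2 * y 5 + x 5 * y 2 - x 3 * y 4 - x 4 * y 3)
      + (x 6 * y 7 - x 7 * y 6) + (x 8 * y 9 - x 9 * y 8)
  | ⟨2, _⟩ => x 0 * y 2 + x 2 * y 0 + algebraMap F R 4⁻¹ * (x 1 * y 2 + x 2 * y 1)
      + algebraMap F R 4⁻¹ * (x 6 * y 8 - x 8 * y 6)
  | ⟨3, _⟩ => x 0 * y 3 + x 3 * y 0 + algebraMap F R 4⁻¹ * (x 1 * y 3 + x 3 * y 1)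
      + algebraMap F R 4⁻¹ * (x 6 * y 9 - x 9 * y 6)
  | ⟨4, _⟩ => x 0 * y 4 + x 4 * y 0 + algebraMap F R 4⁻¹ * (x 1 * y 4 + x 4 * y 1)
      + algebraMap F R 4⁻¹ * (x 7 * y 8 - x 8 * y 7)
  | ⟨5, _⟩ => x 0 * y 5 + x 5 * y 0 + algebraMap F R 4⁻¹ * (x 1 * y 5 + x 5 * y 1)
      + algebraMap F R 4⁻¹ * (x 7 * y 9 - x 9 * y 7)
  | ⟨6, _⟩ => x 0 * y 6 + x 6 * y 0 + algebraMap F R 2⁻¹ * (x 1 * y 6 + x 6 * y 1)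
      + algebraMap F R 2⁻¹ * (x 2 * y 9 + x 9 * y 2) - algebraMap F R 2⁻¹ * (x 3 * y 8 + x 8 * y 3)
  | ⟨7, _⟩ => x 0 * y 7 + x 7 * y 0 + algebraMap F R 2⁻¹ * (x 1 * y 7 + x 7 * y 1)
      + algebraMap F R 2⁻¹ * (x 4 * y 9 + x 9 * y 4) - algebraMap F R 2⁻¹ * (x 5 * y 8 + x 8 * y 5)
  | ⟨8, _⟩ => x 0 * y 8 + x 8 * y 0 + algebraMap F R 2⁻¹ * (x 1 * y 8 + x 8 * y 1)
      - algebraMap F R 2⁻¹ * (x 2 * y 7 + x 7 * y 2) + algebraMap F R 2⁻¹ * (x 4 * y 6 + x 6 * y 4)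
  | ⟨9, _⟩ => x 0 * y 9 + x 9 * y 0 + algebraMap F R 2⁻¹ * (x 1 * y 9 + x 9 * y 1)
      - algebraMap F R 2⁻¹ * (x 3 * y 7 + x 7 * y 3) + algebraMap F R 2⁻¹ * (x 5 * y 6 + x 6 * y 5)

instance : Mul (K10A F R) := ⟨mulFun⟩

lemma mul_def (x y : K10A F R) : x * y = mulFun x y := rfl

@[simp] lemma add_apply (x y : K10A F R) (i : Fin 10) : (x + y) i = x i + y i := rfl
@[simp] lemma sub_apply (x y : K10A F R) (i : Fin 10) : (x - y) i = x i - y i := rfl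
@[simp] lemma neg_apply (x : K10A F R) (i : Fin 10) : (-x) i = -(x i) := rfl
@[simp] lemma zero_apply (i : Fin 10) : (0 : K10A F R) i = 0 := rfl
@[simp] lemma smul_apply (S : Type) [Semiring S] [Module S R] (c : S) (x : K10A F R) (i : Fin 10) :
    (c • x) i = c • (x i) := rfl

variable (F R)

def even (S : Type) [Semiring S] [Module S R] : Submodule S (K10A F R) :=
  stdSub S R 10 {0, 1, 2, 3, 4, 5}
def odd (S : Type) [Semiring S] [Module S R] : Submodule S (K10A F R) :=
  stdSub S R 10 {6, 7, 8, 9}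

/-- The unity `1`. -/
def oneE : K10A F R := ![1, 0, 0, 0, 0, 0, 0, 0, 0, 0]
/-- The element `a ⊗ a`. -/
def aaE : K10A F R := ![0, 1, 0, 0, 0, 0, 0, 0, 0, 0]
/-- The element `v ⊗ w ∈ W ⊗ W`. -/
def wwE (w w' : Fin 2 → R) : K10A F R :=
  ![0, 0, w 0 * w' 0, w 0 * w' 1, w 1 * w' 0, w 1 * w' 1, 0, 0, 0, 0]
/-- The element `w ⊗ a`, `w ∈ W ⊗ R`. -/
def waE (w : Fin 2 → R) : K10A F R := ![0, 0, 0, 0, 0, 0, w 0, w 1, 0, 0]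
/-- The element `a ⊗ w`, `w ∈ W ⊗ R`. -/
def awE (w : Fin 2 → R) : K10A F R := ![0, 0, 0, 0, 0, 0, 0, 0, w 0, w 1]
/-- The exchange automorphism `τ`, `τ(x ⊗ y) = (-1)^{|x||y|} y ⊗ x`. -/
def tauFun (x : K10A F R) : K10A F R := fun i =>
  match i with
  | ⟨0, _⟩ => x 0
  | ⟨1, _⟩ => x 1
  | ⟨2, _⟩ => -x 2
  | ⟨3, _⟩ => -x 4
  | ⟨4, _⟩ => -x 3
  | ⟨5, _⟩ => -x 5
  | ⟨6, _⟩ => x 8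
  | ⟨7, _⟩ => x 9
  | ⟨8, _⟩ => x 6
  | ⟨9, _⟩ => x 7

end K10A

end Algebras

end Kac

namespace Kac
namespace K10A

variable {F : Type} [Field F] {R : Type} [CommRing R] [Algebra F R]

instance : NonUnitalNonAssocRing (K10A F R) where
  __ := (inferInstance : AddCommGroup (K10A F R))
  __ := (inferInstance : Mul (K10A F R))
  left_distrib x y z := by
    show mulFun x (y + z) = mulFun x y + mulFun x z
    funext i; fin_cases i <;> (simp only [mulFun, add_apply]; ring)
  right_distrib x y z := by
    show mulFun (x + y) z = mulFun x z + mulFun y z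
    funext i; fin_cases i <;> (simp only [mulFun, add_apply]; ring)
  zero_mul x := by
    show mulFun 0 x = 0
    funext i; fin_cases i <;> (simp only [mulFun, zero_apply]; ring)
  mul_zero x := by
    show mulFun x 0 = 0
    funext i; fin_cases i <;> (simp only [mulFun, zero_apply]; ring)

instance (S : Type) [CommSemiring S] [Algebra S R] :
    SMulCommClass S (K10A F R) (K10A F R) where
  smul_comm c x y := by
    show c • mulFun x y = mulFun x (c • y)
    funext i; fin_cases i <;>
      (simp only [mulFun, smul_apply, Algebra.smul_def]; ring)

instance (S : Type) [CommSemiring S] [Algebra S R] :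
    IsScalarTower S (K10A F R) (K10A F R) where
  smul_assoc c x y := by
    show mulFun (c • x) y = c • mulFun x y
    funext i; fin_cases i <;>
      (simp only [mulFun, smul_apply, Algebra.smul_def]; ring)

end K10A
end Kac

namespace Kac
namespace K10A

section Tau

variable {F : Type} [Field F] {K : Type} [Field K] [Algebra F K]

/-- The map `τ ⊗ σ` on `K₁₀ ⊗_F K` (realized as `K10A F K`). -/
def tauSigmaFun (σ : K ≃ₐ[F] K) (x : K10A F K) : K10A F K := fun i =>
  match i with
  | ⟨0, _⟩ => σ (x 0)
  | ⟨1, _⟩ => σ (x 1)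
  | ⟨2, _⟩ => -σ (x 2)
  | ⟨3, _⟩ => -σ (x 4)
  | ⟨4, _⟩ => -σ (x 3)
  | ⟨5, _⟩ => -σ (x 5)
  | ⟨6, _⟩ => σ (x 8)
  | ⟨7, _⟩ => σ (x 9)
  | ⟨8, _⟩ => σ (x 6)
  | ⟨9, _⟩ => σ (x 7)

variable (σ : K ≃ₐ[F] K)

lemma tauSigmaFun_add (x y : K10A F K) :
    tauSigmaFun σ (x + y) = tauSigmaFun σ x + tauSigmaFun σ y := by
  funext i; fin_cases i <;> (simp [tauSigmaFun]; try ring)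

lemma tauSigmaFun_smul (c : F) (x : K10A F K) :
    tauSigmaFun σ (c • x) = c • tauSigmaFun σ x := by
  funext i; fin_cases i <;> (simp [tauSigmaFun, Algebra.smul_def, map_mul, AlgEquiv.commutes]; try ring)

lemma tauSigmaFun_mul (x y : K10A F K) :
    tauSigmaFun σ (x * y) = tauSigmaFun σ x * tauSigmaFun σ y := by
  funext i; fin_cases i <;>
    (simp only [tauSigmaFun, mul_def, mulFun, map_add, map_sub, map_mul, map_neg,
      AlgEquiv.commutes]; ring)

/-- Galois descent: the `F`-form `K₁₀,K = {X ∈ K₁₀ ⊗ K : (τ⊗σ)(X) = X}`. -/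
def fixedK10 : Submodule F (K10A F K) where
  carrier := {x | tauSigmaFun σ x = x}
  add_mem' {a b} ha hb := by
    show tauSigmaFun σ (a + b) = a + b
    rw [tauSigmaFun_add, Set.mem_setOf_eq.mp ha, Set.mem_setOf_eq.mp hb]
  zero_mem' := by
    show tauSigmaFun σ 0 = 0
    funext i; fin_cases i <;> (simp [tauSigmaFun]; try ring)
  smul_mem' c x hx := by
    show tauSigmaFun σ (c • x) = c • x
    rw [tauSigmaFun_smul, Set.mem_setOf_eq.mp hx]

lemma mem_fixedK10 {x : K10A F K} : x ∈ fixedK10 σ ↔ tauSigmaFun σ x = x := Iff.rfl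

instance : Mul ↥(fixedK10 σ) :=
  ⟨fun x y => ⟨x.1 * y.1, by
    have hx : tauSigmaFun σ x.1 = x.1 := x.2
    have hy : tauSigmaFun σ y.1 = y.1 := y.2
    show tauSigmaFun σ (x.1 * y.1) = x.1 * y.1
    rw [tauSigmaFun_mul, hx, hy]⟩⟩

@[simp] lemma coe_mul (x y : ↥(fixedK10 σ)) : ((x * y : ↥(fixedK10 σ)) : K10A F K) = x.1 * y.1 :=
  rfl

instance : NonUnitalNonAssocRing ↥(fixedK10 σ) where
  __ := (inferInstance : AddCommGroup ↥(fixedK10 σ))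
  __ := (inferInstance : Mul ↥(fixedK10 σ))
  left_distrib x y z := Subtype.ext (left_distrib x.1 y.1 z.1)
  right_distrib x y z := Subtype.ext (right_distrib x.1 y.1 z.1)
  zero_mul x := Subtype.ext (zero_mul x.1)
  mul_zero x := Subtype.ext (mul_zero x.1)

instance : SMulCommClass F ↥(fixedK10 σ) ↥(fixedK10 σ) :=
  ⟨fun c x y => Subtype.ext (smul_comm c x.1 y.1)⟩

instance : IsScalarTower F ↥(fixedK10 σ) ↥(fixedK10 σ) :=
  ⟨fun c x y => Subtype.ext (smul_assoc c x.1 y.1)⟩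

/-- The even part of `K₁₀,K`, as an `F`-submodule. -/
def fixedEven : Submodule F ↥(fixedK10 σ) := (even F K F).comap (fixedK10 σ).subtype
/-- The odd part of `K₁₀,K`, as an `F`-submodule. -/
def fixedOdd : Submodule F ↥(fixedK10 σ) := (odd F K F).comap (fixedK10 σ).subtype

end Tau

end K10A
end Kac

namespace Kac
namespace K10A

section Descent

variable {F : Type} [Field F] {K : Type} [Field K] [Algebra F K]

instance : IsScalarTower F K (K10A F K) := inferInstanceAs (IsScalarTower F K (Fin 10 → K))

/-! ### The action of `SL₂ × SL₂` -/

/-- The natural action of `SL(W) × SL(W)` on `K₁₀`, in coordinates. -/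
def slFun (g h : SL2 K) (x : K10A F K) : K10A F K := fun i =>
  match i with
  | ⟨0, _⟩ => x 0
  | ⟨1, _⟩ => x 1
  | ⟨2, _⟩ => g 0 0 * (h 0 0 * x 2 + h 0 1 * x 3) + g 0 1 * (h 0 0 * x 4 + h 0 1 * x 5)
  | ⟨3, _⟩ => g 0 0 * (h 1 0 * x 2 + h 1 1 * x 3) + g 0 1 * (h 1 0 * x 4 + h 1 1 * x 5)
  | ⟨4, _⟩ => g 1 0 * (h 0 0 * x 2 + h 0 1 * x 3) + g 1 1 * (h 0 0 * x 4 + h 0 1 * x 5)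
  | ⟨5, _⟩ => g 1 0 * (h 1 0 * x 2 + h 1 1 * x 3) + g 1 1 * (h 1 0 * x 4 + h 1 1 * x 5)
  | ⟨6, _⟩ => g 0 0 * x 6 + g 0 1 * x 7
  | ⟨7, _⟩ => g 1 0 * x 6 + g 1 1 * x 7
  | ⟨8, _⟩ => h 0 0 * x 8 + h 0 1 * x 9
  | ⟨9, _⟩ => h 1 0 * x 8 + h 1 1 * x 9

/-- The natural action of `SL(W) × SL(W)` on `K₁₀`. -/
def slMap (g h : SL2 K) : K10A F K →ₗ[K] K10A F K where
  toFun := slFun g h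
  map_add' x y := by
    funext i; fin_cases i <;> simp only [slFun, add_apply] <;> ring
  map_smul' c x := by
    funext i; fin_cases i <;> simp only [slFun, smul_apply, smul_eq_mul, RingHom.id_apply] <;> ring

lemma slMap_apply (g h : SL2 K) (x : K10A F K) : slMap g h x = slFun g h x := rfl

lemma slMap_mul (g h : SL2 K) (x y : K10A F K) :
    slMap g h (x * y) = slMap g h x * slMap g h y := by
  have hg : g 0 0 * g 1 1 - g 0 1 * g 1 0 = 1 := by rw [← Matrix.det_fin_two, g.det_coe]
  have hh : h 0 0 * h 1 1 - h 0 1 * h 1 0 = 1 := by rw [← Matrix.det_fin_two, h.det_coe]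
  funext i
  fin_cases i <;> simp only [slMap_apply, slFun, mul_def, mulFun]
  · linear_combination
      (-algebraMap F K (3/4) * (x 2 * y 5 + x 5 * y 2 - x 3 * y 4 - x 4 * y 3)
        * (h 0 0 * h 1 1 - h 0 1 * h 1 0) + algebraMap F K (3/8) * (x 6 * y 7 - x 7 * y 6)) * hg
      + (-algebraMap F K (3/4) * (x 2 * y 5 + x 5 * y 2 - x 3 * y 4 - x 4 * y 3)
        + algebraMap F K (3/8) * (x 8 * y 9 - x 9 * y 8)) * hh
  · linear_combination
      ((x 2 * y 5 + x 5 * y 2 - x 3 * y 4 - x 4 * y 3)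
        * (h 0 0 * h 1 1 - h 0 1 * h 1 0) - (x 6 * y 7 - x 7 * y 6)) * hg
      + ((x 2 * y 5 + x 5 * y 2 - x 3 * y 4 - x 4 * y 3) - (x 8 * y 9 - x 9 * y 8)) * hh
  · ring
  · ring
  · ring
  · ring
  · linear_combination -algebraMap F K 2⁻¹ *
      (g 0 0 * (x 2 * y 9 + x 9 * y 2 - x 3 * y 8 - x 8 * y 3)
        + g 0 1 * (x 4 * y 9 + x 9 * y 4 - x 5 * y 8 - x 8 * y 5)) * hh
  · linear_combination -algebraMap F K 2⁻¹ *
      (g 1 0 * (x 2 * y 9 + x 9 * y 2 - x 3 * y 8 - x 8 * y 3)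
        + g 1 1 * (x 4 * y 9 + x 9 * y 4 - x 5 * y 8 - x 8 * y 5)) * hh
  · linear_combination -algebraMap F K 2⁻¹ *
      (h 0 0 * (x 4 * y 6 + x 6 * y 4 - x 2 * y 7 - x 7 * y 2)
        + h 0 1 * (x 5 * y 6 + x 6 * y 5 - x 3 * y 7 - x 7 * y 3)) * hg
  · linear_combination -algebraMap F K 2⁻¹ *
      (h 1 0 * (x 4 * y 6 + x 6 * y 4 - x 2 * y 7 - x 7 * y 2)
        + h 1 1 * (x 5 * y 6 + x 6 * y 5 - x 3 * y 7 - x 7 * y 3)) * hg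

lemma slMap_inv_apply (g h : SL2 K) (x : K10A F K) : slMap g⁻¹ h⁻¹ (slMap g h x) = x := by
  have hg : g 0 0 * g 1 1 - g 0 1 * g 1 0 = 1 := by rw [← Matrix.det_fin_two, g.det_coe]
  have hh : h 0 0 * h 1 1 - h 0 1 * h 1 0 = 1 := by rw [← Matrix.det_fin_two, h.det_coe]
  funext i
  fin_cases i <;>
    simp only [slMap_apply, slFun] <;> simp [Matrix.SpecialLinearGroup.SL2_inv_expl]
  · linear_combination x 2 * (h 0 0 * h 1 1 - h 0 1 * h 1 0) * hg + x 2 * hh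
  · linear_combination x 3 * (h 0 0 * h 1 1 - h 0 1 * h 1 0) * hg + x 3 * hh
  · linear_combination x 4 * (h 0 0 * h 1 1 - h 0 1 * h 1 0) * hg + x 4 * hh
  · linear_combination x 5 * (h 0 0 * h 1 1 - h 0 1 * h 1 0) * hg + x 5 * hh
  · linear_combination x 6 * hg
  · linear_combination x 7 * hg
  · linear_combination x 8 * hh
  · linear_combination x 9 * hh

lemma slMap_bijective (g h : SL2 K) : Function.Bijective (slMap (F := F) g h) :=
  Function.bijective_iff_has_inverse.mpr ⟨slMap g⁻¹ h⁻¹, slMap_inv_apply g h, fun x => by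
    simpa using slMap_inv_apply g⁻¹ h⁻¹ x⟩

lemma mem_even {R S : Type} [CommRing R] [Algebra F R] [Semiring S] [Module S R] {x : K10A F R} :
    x ∈ even F R S ↔ x 6 = 0 ∧ x 7 = 0 ∧ x 8 = 0 ∧ x 9 = 0 := by
  constructor
  · intro hx
    exact ⟨hx 6 (by simp), hx 7 (by simp), hx 8 (by simp), hx 9 (by simp)⟩
  · rintro ⟨h6, h7, h8, h9⟩ i hi
    fin_cases i <;> first | assumption | simp at hi

lemma mem_odd {R S : Type} [CommRing R] [Algebra F R] [Semiring S] [Module S R] {x : K10A F R} :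
    x ∈ odd F R S ↔ x 0 = 0 ∧ x 1 = 0 ∧ x 2 = 0 ∧ x 3 = 0 ∧ x 4 = 0 ∧ x 5 = 0 := by
  constructor
  · intro hx
    exact ⟨hx 0 (by simp), hx 1 (by simp), hx 2 (by simp), hx 3 (by simp), hx 4 (by simp),
      hx 5 (by simp)⟩
  · rintro ⟨h0, h1, h2, h3, h4, h5⟩ i hi
    fin_cases i <;> first | assumption | simp at hi

lemma slMap_mem_even (g h : SL2 K) {x : K10A F K} (hx : x ∈ even F K K) :
    slMap g h x ∈ even F K K := by
  obtain ⟨h6, h7, h8, h9⟩ := mem_even.mp hx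
  exact mem_even.mpr (by simp [slMap_apply, slFun, h6, h7, h8, h9])

lemma slMap_mem_odd (g h : SL2 K) {x : K10A F K} (hx : x ∈ odd F K K) :
    slMap g h x ∈ odd F K K := by
  obtain ⟨h0, h1, h2, h3, h4, h5⟩ := mem_odd.mp hx
  exact mem_odd.mpr (by simp [slMap_apply, slFun, h0, h1, h2, h3, h4, h5])

lemma mem_even_of_slMap_mem_even (g h : SL2 K) {x : K10A F K} (hx : slMap g h x ∈ even F K K) :
    x ∈ even F K K :=
  slMap_inv_apply g h x ▸ slMap_mem_even g⁻¹ h⁻¹ hx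

lemma mem_odd_of_slMap_mem_odd (g h : SL2 K) {x : K10A F K} (hx : slMap g h x ∈ odd F K K) :
    x ∈ odd F K K :=
  slMap_inv_apply g h x ▸ slMap_mem_odd g⁻¹ h⁻¹ hx

/-- `slMap g h` in terms of the images of the generators `W ⊗ a` and `a ⊗ W`. -/
lemma slMap_eq (hchar : (2 : F) ≠ 0) (g h : SL2 K) (x : K10A F K) :
    slMap g h x = x 0 • oneE F K + x 1 • aaE F K
      + (x 2 * 4) • (waE F K (fun i => g i 0) * awE F K (fun i => h i 0))
      + (x 3 * 4) • (waE F K (fun i => g i 0) * awE F K (fun i => h i 1))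
      + (x 4 * 4) • (waE F K (fun i => g i 1) * awE F K (fun i => h i 0))
      + (x 5 * 4) • (waE F K (fun i => g i 1) * awE F K (fun i => h i 1))
      + x 6 • waE F K (fun i => g i 0) + x 7 • waE F K (fun i => g i 1)
      + x 8 • awE F K (fun i => h i 0) + x 9 • awE F K (fun i => h i 1) := by
  have h4 : (4 : K) * algebraMap F K 4⁻¹ = 1 := by
    rw [map_inv₀, map_ofNat]
    refine mul_inv_cancel₀ ?_
    have h2 : (algebraMap F K) 2 ≠ 0 := (map_ne_zero _).mpr hchar
    rw [map_ofNat] at h2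
    rw [show (4 : K) = 2 * 2 by norm_num]
    exact mul_ne_zero h2 h2
  funext i
  fin_cases i <;>
    simp only [slMap_apply, slFun, add_apply, smul_apply, mul_def, mulFun] <;>
    simp [oneE, aaE, waE, awE, -map_inv₀]
  · linear_combination (-(g 0 0 * (h 0 0 * x 2 + h 0 1 * x 3)) -
      g 0 1 * (h 0 0 * x 4 + h 0 1 * x 5)) * h4
  · linear_combination (-(g 0 0 * (h 1 0 * x 2 + h 1 1 * x 3)) -
      g 0 1 * (h 1 0 * x 4 + h 1 1 * x 5)) * h4
  · linear_combination (-(g 1 0 * (h 0 0 * x 2 + h 0 1 * x 3)) -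
      g 1 1 * (h 0 0 * x 4 + h 0 1 * x 5)) * h4
  · linear_combination (-(g 1 0 * (h 1 0 * x 2 + h 1 1 * x 3)) -
      g 1 1 * (h 1 0 * x 4 + h 1 1 * x 5)) * h4
  all_goals ring

/-! ### The summands `W ⊗ a` and `a ⊗ W` of the odd part -/

variable (F K) in
/-- The summand `W ⊗ a` of the odd part. -/
def oddLeft : Submodule K (K10A F K) := stdSub K K 10 {6, 7}

variable (F K) in
/-- The summand `a ⊗ W` of the odd part. -/
def oddRight : Submodule K (K10A F K) := stdSub K K 10 {8, 9}

lemma mem_oddLeft {x : K10A F K} : x ∈ oddLeft F K ↔ ∃ w, waE F K w = x := by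
  constructor
  · intro hx
    refine ⟨![x 6, x 7], ?_⟩
    funext i
    fin_cases i <;> first | rfl | exact (hx _ (by simp)).symm
  · rintro ⟨w, rfl⟩ i hi
    fin_cases i <;> first | rfl | simp at hi

lemma mem_oddRight {x : K10A F K} : x ∈ oddRight F K ↔ ∃ w, awE F K w = x := by
  constructor
  · intro hx
    refine ⟨![x 8, x 9], ?_⟩
    funext i
    fin_cases i <;> first | rfl | exact (hx _ (by simp)).symm
  · rintro ⟨w, rfl⟩ i hi
    fin_cases i <;> first | rfl | simp at hi

lemma waE_mem_odd (w : Fin 2 → K) : waE F K w ∈ odd F K K :=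
  mem_odd.mpr ⟨rfl, rfl, rfl, rfl, rfl, rfl⟩

lemma awE_mem_odd (w : Fin 2 → K) : awE F K w ∈ odd F K K :=
  mem_odd.mpr ⟨rfl, rfl, rfl, rfl, rfl, rfl⟩

lemma waE_add (w w' : Fin 2 → K) : waE F K (w + w') = waE F K w + waE F K w' := by
  funext i; rw [add_apply]; fin_cases i <;> simp [waE]

lemma awE_add (w w' : Fin 2 → K) : awE F K (w + w') = awE F K w + awE F K w' := by
  funext i; rw [add_apply]; fin_cases i <;> simp [awE]

lemma waE_smul (c : K) (w : Fin 2 → K) : waE F K (c • w) = c • waE F K w := by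
  funext i; rw [smul_apply]; fin_cases i <;> simp [waE]

lemma awE_smul (c : K) (w : Fin 2 → K) : awE F K (c • w) = c • awE F K w := by
  funext i; rw [smul_apply]; fin_cases i <;> simp [awE]

lemma waE_injective : Function.Injective (waE F K) := fun w w' h => by
  funext i; fin_cases i
  · exact congrFun h 6
  · exact congrFun h 7

lemma awE_injective : Function.Injective (awE F K) := fun w w' h => by
  funext i; fin_cases i
  · exact congrFun h 8
  · exact congrFun h 9

lemma waE_ne_awE {w w' : Fin 2 → K} (hw : w ≠ 0) : waE F K w ≠ awE F K w' := fun h => hw <| by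
  funext i; fin_cases i
  · exact congrFun h 6
  · exact congrFun h 7

variable (F K) in
/-- The element `a ⊗ a - 3/8` spanning the product of `W ⊗ a` with itself. -/
def coreE : K10A F K := aaE F K - (3 / 8 : F) • oneE F K

/-- The determinant form on `W`. -/
def symp (w w' : Fin 2 → K) : K := w 0 * w' 1 - w 1 * w' 0

lemma waE_mul_waE (w w' : Fin 2 → K) :
    waE F K w * waE F K w' = symp w w' • coreE F K := by
  funext i
  fin_cases i <;> simp only [mul_def, mulFun, smul_apply, coreE, sub_apply] <;>
    simp [waE, aaE, oneE, symp, Algebra.smul_def]; ring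

lemma awE_mul_awE (w w' : Fin 2 → K) :
    awE F K w * awE F K w' = symp w w' • coreE F K := by
  funext i
  fin_cases i <;> simp only [mul_def, mulFun, smul_apply, coreE, sub_apply] <;>
    simp [awE, aaE, oneE, symp, Algebra.smul_def]; ring

lemma awE_mul_waE (w w' : Fin 2 → K) : awE F K w * waE F K w' = -(waE F K w' * awE F K w) := by
  funext i
  fin_cases i <;> simp only [mul_def, mulFun, neg_apply] <;>
    simp [waE, awE, -mul_eq_mul_right_iff, -mul_eq_mul_left_iff, -neg_inj, -map_inv₀] <;> ring

lemma coreE_mul_of_mem_odd (hchar : (2 : F) ≠ 0) {x : K10A F K} (hx : x ∈ odd F K K) :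
    coreE F K * x = (8⁻¹ : F) • x := by
  have h : algebraMap F K 2⁻¹ - algebraMap F K (3 / 8) = algebraMap F K 8⁻¹ := by
    rw [← map_sub]
    congr 1
    have h8 : (8 : F) ≠ 0 := by
      rw [show (8 : F) = 2 ^ 3 by norm_num]; exact pow_ne_zero _ hchar
    field_simp
    norm_num
  obtain ⟨h0, h1, h2, h3, h4, h5⟩ := mem_odd.mp hx
  funext i
  fin_cases i <;> simp only [mul_def, mulFun, smul_apply, coreE, sub_apply] <;>
    simp [aaE, oneE, Algebra.smul_def, h0, h1, h2, h3, h4, h5, -map_inv₀, -map_div₀]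
  · linear_combination x 6 * h
  · linear_combination x 7 * h
  · linear_combination x 8 * h
  · linear_combination x 9 * h

lemma oneE_mul (x : K10A F K) : oneE F K * x = x := by
  funext i
  fin_cases i <;> simp only [mul_def, mulFun] <;> simp [oneE]

lemma mul_oneE (x : K10A F K) : x * oneE F K = x := by
  funext i
  fin_cases i <;> simp only [mul_def, mulFun] <;> simp [oneE]

lemma mul_mul_of_mem_odd (hchar : (2 : F) ≠ 0) {x y : K10A F K}
    (hx : x ∈ odd F K K) (hy : y ∈ odd F K K) :
    x * (x * y) = (8⁻¹ : F) • (waE F K ((x 6 * y 7 - x 7 * y 6) • ![x 6, x 7])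
      + awE F K ((x 8 * y 9 - x 9 * y 8) • ![x 8, x 9])) := by
  have h8 : (8 : F) ≠ 0 := by
    rw [show (8 : F) = 2 ^ 3 by norm_num]; exact pow_ne_zero _ hchar
  have h4 : (4 : F) ≠ 0 := by
    rw [show (4 : F) = 2 ^ 2 by norm_num]; exact pow_ne_zero _ hchar
  have e38 : algebraMap F K (3 / 8) = 3 * algebraMap F K 8⁻¹ := by
    rw [div_eq_mul_inv, map_mul, map_ofNat]
  have e2 : algebraMap F K 2⁻¹ = 4 * algebraMap F K 8⁻¹ := by
    rw [← map_ofNat (algebraMap F K) 4, ← map_mul]; congr 1; field_simp; norm_num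
  have e24 : algebraMap F K 2⁻¹ * algebraMap F K 4⁻¹ = algebraMap F K 8⁻¹ := by
    rw [← map_mul]; congr 1; field_simp; norm_num
  obtain ⟨h0, h1, h2, h3, h4, h5⟩ := mem_odd.mp hx
  obtain ⟨k0, k1, k2, k3, k4, k5⟩ := mem_odd.mp hy
  funext i
  fin_cases i <;> simp only [mul_def, mulFun, smul_apply, add_apply] <;>
    simp [waE, awE, Algebra.smul_def, h0, h1, h2, h3, h4, h5, k0, k1, k2, k3, k4, k5,
      -map_inv₀, -map_div₀]
  · linear_combination x 6 * (x 6 * y 7 - x 7 * y 6 + x 8 * y 9 - x 9 * y 8) * (e2 - e38)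
      + (x 9 * (x 6 * y 8 - x 8 * y 6) - x 8 * (x 6 * y 9 - x 9 * y 6)) * e24
  · linear_combination x 7 * (x 6 * y 7 - x 7 * y 6 + x 8 * y 9 - x 9 * y 8) * (e2 - e38)
      + (x 9 * (x 7 * y 8 - x 8 * y 7) - x 8 * (x 7 * y 9 - x 9 * y 7)) * e24
  · linear_combination x 8 * (x 6 * y 7 - x 7 * y 6 + x 8 * y 9 - x 9 * y 8) * (e2 - e38)
      + (x 6 * (x 7 * y 8 - x 8 * y 7) - x 7 * (x 6 * y 8 - x 8 * y 6)) * e24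
  · linear_combination x 9 * (x 6 * y 7 - x 7 * y 6 + x 8 * y 9 - x 9 * y 8) * (e2 - e38)
      + (x 6 * (x 7 * y 9 - x 9 * y 7) - x 7 * (x 6 * y 9 - x 9 * y 6)) * e24

lemma exists_SL2_of_symp_eq_one {w w' : Fin 2 → K} (h : symp w w' = 1) :
    ∃ g : SL2 K, (fun i => g i 0) = w ∧ (fun i => g i 1) = w' := by
  refine ⟨⟨!![w 0, w' 0; w 1, w' 1], ?_⟩, ?_, ?_⟩
  · rw [Matrix.det_fin_two_of, ← h, symp]; ring
  · funext i; fin_cases i <;> rfl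
  · funext i; fin_cases i <;> rfl

/-- A semilinear involution of the plane compatible with the determinant form fixes a
symplectic basis. -/
lemma exists_fixed_symp_eq_one {σ : K ≃ₐ[F] K} (h2 : (2 : K) ≠ 0) {θ : K} (hθ0 : θ ≠ 0)
    (hθ : σ θ = -θ) {f : (Fin 2 → K) → (Fin 2 → K)} (hadd : ∀ w w', f (w + w') = f w + f w')
    (hsmul : ∀ (c : K) w, f (c • w) = σ c • f w) (hinv : ∀ w, f (f w) = w)
    (hsymp : ∀ w w', symp (f w) (f w') = σ (symp w w')) :
    ∃ w w', f w = w ∧ f w' = w' ∧ symp w w' = 1 := by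
  have hfix (w : Fin 2 → K) : f (w + f w) = w + f w := by rw [hadd, hinv, add_comm]
  have hsplit (w : Fin 2 → K) :
      ∃ p q, f p = p ∧ f q = q ∧ w = (2⁻¹ : K) • p + (2⁻¹ * θ⁻¹) • q := by
    refine ⟨w + f w, θ • w + f (θ • w), hfix _, hfix _, ?_⟩
    rw [hsmul, hθ]
    funext i
    simp only [Pi.add_apply, Pi.smul_apply, smul_eq_mul]
    field_simp
    ring
  by_cases hzero : ∀ p q, f p = p → f q = q → symp p q = 0
  · exfalso
    obtain ⟨p, q, hp, hq, h0⟩ := hsplit ![1, 0]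
    obtain ⟨p', q', hp', hq', h1⟩ := hsplit ![0, 1]
    have h : symp (![1, 0] : Fin 2 → K) ![0, 1] = 1 := by simp [symp]
    rw [h0, h1] at h
    have e : symp ((2⁻¹ : K) • p + (2⁻¹ * θ⁻¹) • q) ((2⁻¹ : K) • p' + (2⁻¹ * θ⁻¹) • q')
        = 2⁻¹ * 2⁻¹ * symp p p' + 2⁻¹ * 2⁻¹ * θ⁻¹ * (symp p q' + symp q p')
          + 2⁻¹ * 2⁻¹ * θ⁻¹ * θ⁻¹ * symp q q' := by
      simp only [symp, Pi.add_apply, Pi.smul_apply, smul_eq_mul]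
      ring
    rw [e, hzero _ _ hp hp', hzero _ _ hp hq', hzero _ _ hq hp', hzero _ _ hq hq'] at h
    simp at h
  · push Not at hzero
    obtain ⟨p, q, hp, hq, hne⟩ := hzero
    refine ⟨(symp p q)⁻¹ • p, q, ?_, hq, ?_⟩
    · rw [hsmul, hp, map_inv₀, ← hsymp, hp, hq]
    · have e : symp ((symp p q)⁻¹ • p) q = (symp p q)⁻¹ * symp p q := by
        simp only [symp, Pi.smul_apply, smul_eq_mul]
        ring
      rw [e, inv_mul_cancel₀ hne]

/-! ### Semilinear involutions of `K₁₀ ⊗ K` -/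

/-- Multiplicative parity-preserving `σ`-semilinear involutions of `K₁₀ ⊗ K`. -/
structure IsDescentMap (σ : K ≃ₐ[F] K) (ρ : K10A F K → K10A F K) : Prop where
  map_add : ∀ x y, ρ (x + y) = ρ x + ρ y
  map_smul : ∀ (c : K) x, ρ (c • x) = σ c • ρ x
  map_mul : ∀ x y, ρ (x * y) = ρ x * ρ y
  map_odd : ∀ x ∈ odd F K K, ρ x ∈ odd F K K
  invol : ∀ x, ρ (ρ x) = x

lemma exists_smul_iff_mem_oddLeft_or (hchar : (2 : F) ≠ 0) {x : K10A F K} (hx : x ∈ odd F K K) :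
    (∀ y ∈ odd F K K, ∃ c : K, x * (x * y) = c • x) ↔ x ∈ oddLeft F K ∨ x ∈ oddRight F K := by
  have h8 : (algebraMap F K) 8⁻¹ ≠ 0 := (map_ne_zero _).mpr <| inv_ne_zero <| by
    rw [show (8 : F) = 2 ^ 3 by norm_num]; exact pow_ne_zero _ hchar
  constructor
  · intro h
    by_contra! hne
    have key (w : Fin 2 → K) : (x 6 * w 1 - x 7 * w 0) * x 6 = 0 ∧
        (x 6 * w 1 - x 7 * w 0) * x 7 = 0 := by
      obtain ⟨c, hc⟩ := h _ (waE_mem_odd w)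
      rw [mul_mul_of_mem_odd hchar hx (waE_mem_odd w)] at hc
      have c6 := congrFun hc 6
      have c7 := congrFun hc 7
      have c8 := congrFun hc 8
      have c9 := congrFun hc 9
      rw [smul_apply, smul_apply, add_apply] at c6 c7 c8 c9
      simp only [waE, awE, Algebra.smul_def] at c6 c7 c8 c9
      simp [-map_inv₀] at c6 c7 c8 c9
      have hc0 : c = 0 := by
        by_contra hc0
        refine hne.1 (mem_oddLeft.mpr ⟨![x 6, x 7], ?_⟩)
        obtain ⟨h0, h1, h2, h3, h4, h5⟩ := mem_odd.mp hx
        funext i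
        fin_cases i <;> simp_all [waE]
      subst hc0
      simp_all
    have k0 := key ![1, 0]
    have k1 := key ![0, 1]
    simp at k0 k1
    refine hne.2 (mem_oddRight.mpr ⟨![x 8, x 9], ?_⟩)
    obtain ⟨h0, h1, h2, h3, h4, h5⟩ := mem_odd.mp hx
    funext i
    fin_cases i <;> simp_all [awE]
  · rintro (h | h) y hy
    · rw [mul_mul_of_mem_odd hchar hx hy]
      obtain ⟨w, rfl⟩ := mem_oddLeft.mp h
      refine ⟨algebraMap F K 8⁻¹ * (w 0 * y 7 - w 1 * y 6), ?_⟩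
      funext i
      rw [smul_apply, smul_apply, add_apply]
      fin_cases i <;> simp [waE, awE, Algebra.smul_def, mul_assoc]
    · rw [mul_mul_of_mem_odd hchar hx hy]
      obtain ⟨w, rfl⟩ := mem_oddRight.mp h
      refine ⟨algebraMap F K 8⁻¹ * (w 0 * y 9 - w 1 * y 8), ?_⟩
      funext i
      rw [smul_apply, smul_apply, add_apply]
      fin_cases i <;> simp [waE, awE, Algebra.smul_def, mul_assoc]

lemma oddLeft_le_odd : oddLeft F K ≤ odd F K K := fun x hx => by
  obtain ⟨w, rfl⟩ := mem_oddLeft.mp hx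
  exact waE_mem_odd w

lemma oddRight_le_odd : oddRight F K ≤ odd F K K := fun x hx => by
  obtain ⟨w, rfl⟩ := mem_oddRight.mp hx
  exact awE_mem_odd w

namespace IsDescentMap

variable {σ : K ≃ₐ[F] K} {ρ : K10A F K → K10A F K}

lemma map_mem_oddLeft_or (hρ : IsDescentMap σ ρ) (hchar : (2 : F) ≠ 0) {x : K10A F K}
    (hx : x ∈ oddLeft F K ∨ x ∈ oddRight F K) : ρ x ∈ oddLeft F K ∨ ρ x ∈ oddRight F K := by
  have hx' : x ∈ odd F K K := hx.elim (oddLeft_le_odd ·) (oddRight_le_odd ·)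
  rw [← exists_smul_iff_mem_oddLeft_or hchar (hρ.map_odd x hx')]
  intro y hy
  obtain ⟨c, hc⟩ := (exists_smul_iff_mem_oddLeft_or hchar hx').mpr hx _ (hρ.map_odd y hy)
  refine ⟨σ c, ?_⟩
  rw [← hρ.map_smul, ← hc, hρ.map_mul, hρ.map_mul, hρ.invol]

lemma map_oddLeft_or (hρ : IsDescentMap σ ρ) {P : Submodule K (K10A F K)}
    (hP : ∀ x ∈ P, ρ x ∈ oddLeft F K ∨ ρ x ∈ oddRight F K) :
    (∀ x ∈ P, ρ x ∈ oddLeft F K) ∨ ∀ x ∈ P, ρ x ∈ oddRight F K := by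
  by_contra! h
  obtain ⟨⟨x, hx, hxL⟩, y, hy, hyR⟩ := h
  have hxR := (hP x hx).resolve_left hxL
  have hyL := (hP y hy).resolve_right hyR
  rcases hP _ (P.add_mem hx hy) with h | h <;> rw [hρ.map_add] at h
  · exact hxL ((Submodule.add_mem_iff_left _ hyL).mp h)
  · exact hyR ((Submodule.add_mem_iff_right _ hxR).mp h)

lemma map_oneE (hρ : IsDescentMap σ ρ) : ρ (oneE F K) = oneE F K := by
  rw [← oneE_mul (ρ (oneE F K))]
  conv_lhs => rw [← hρ.invol (oneE F K * _), hρ.map_mul, hρ.invol, mul_oneE, hρ.invol]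

lemma map_smul_base (hρ : IsDescentMap σ ρ) (c : F) (x : K10A F K) :
    ρ (c • x) = c • ρ x := by
  rw [← algebraMap_smul K c x, hρ.map_smul, AlgEquiv.commutes, algebraMap_smul]

lemma map_ne_zero (hρ : IsDescentMap σ ρ) {x : K10A F K} (hx : x ≠ 0) : ρ x ≠ 0 := fun h =>
  hx <| by rw [← hρ.invol x, h, ← zero_smul K (0 : K10A F K), hρ.map_smul, map_zero, zero_smul,
    zero_smul]

end IsDescentMap

/-- The map `id ⊗ σ` on `K₁₀ ⊗_F K`. -/
def conjFun (σ : K ≃ₐ[F] K) (x : K10A F K) : K10A F K := fun i => σ (x i)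

lemma smul_coreE_injective {c d : K} (h : c • coreE F K = d • coreE F K) : c = d := by
  have e : coreE F K 1 = 1 := by
    rw [coreE, sub_apply, smul_apply]
    simp [oneE, aaE]
  simpa only [smul_apply, e, smul_eq_mul, mul_one] using congrFun h 1

lemma waE_ne_zero {w : Fin 2 → K} (hw : w ≠ 0) : waE F K w ≠ 0 := by
  convert waE_ne_awE (F := F) (w' := 0) hw using 1
  funext i
  fin_cases i <;> simp [awE]

namespace IsDescentMap

variable {σ : K ≃ₐ[F] K} {ρ : K10A F K → K10A F K}

lemma map_coreE (hρ : IsDescentMap σ ρ) (hchar : (2 : F) ≠ 0)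
    (hL : (∀ x ∈ oddLeft F K, ρ x ∈ oddLeft F K) ∨ ∀ x ∈ oddLeft F K, ρ x ∈ oddRight F K) :
    ρ (coreE F K) = coreE F K := by
  have hcore : coreE F K = waE F K ![1, 0] * waE F K ![0, 1] := by simp [waE_mul_waE, symp]
  have hx : waE F K (![1, 0] : Fin 2 → K) ∈ odd F K K := waE_mem_odd _
  obtain ⟨κ, hκ⟩ : ∃ κ : K, ρ (coreE F K) = κ • coreE F K := by
    rw [hcore, hρ.map_mul, ← hcore]
    rcases hL with hL | hL
    · obtain ⟨w, hw⟩ := mem_oddLeft.mp (hL _ (mem_oddLeft.mpr ⟨![1, 0], rfl⟩))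
      obtain ⟨w', hw'⟩ := mem_oddLeft.mp (hL _ (mem_oddLeft.mpr ⟨![0, 1], rfl⟩))
      exact ⟨_, by rw [← hw, ← hw', waE_mul_waE]⟩
    · obtain ⟨w, hw⟩ := mem_oddRight.mp (hL _ (mem_oddLeft.mpr ⟨![1, 0], rfl⟩))
      obtain ⟨w', hw'⟩ := mem_oddRight.mp (hL _ (mem_oddLeft.mpr ⟨![0, 1], rfl⟩))
      exact ⟨_, by rw [← hw, ← hw', awE_mul_awE]⟩
  have h8 : (algebraMap F K) 8⁻¹ ≠ 0 := (_root_.map_ne_zero _).mpr <| inv_ne_zero <| by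
    rw [show (8 : F) = 2 ^ 3 by norm_num]; exact pow_ne_zero _ hchar
  have h := congrArg ρ (coreE_mul_of_mem_odd hchar hx)
  rw [hρ.map_mul, hκ, smul_mul_assoc, coreE_mul_of_mem_odd hchar (hρ.map_odd _ hx),
    hρ.map_smul_base, ← algebraMap_smul K (8⁻¹ : F), smul_smul] at h
  have hne : ρ (waE F K ![1, 0]) ≠ 0 := hρ.map_ne_zero (waE_ne_zero fun h0 => by
    simpa using congrFun h0 0)
  have h1 := smul_left_injective K hne h
  rw [hκ, mul_right_cancel₀ h8 (h1.trans (one_mul _).symm), one_smul]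

lemma map_aaE (hρ : IsDescentMap σ ρ) (h : ρ (coreE F K) = coreE F K) :
    ρ (aaE F K) = aaE F K := by
  have e : aaE F K = coreE F K + (3 / 8 : F) • oneE F K := by rw [coreE, sub_add_cancel]
  rw [e, hρ.map_add, h, hρ.map_smul_base, hρ.map_oneE]

/-- Galois descent for a summand of the odd part, parametrized by `φ`. -/
lemma exists_fixed_symp_eq_one (hρ : IsDescentMap σ ρ) (h2 : (2 : K) ≠ 0) {θ : K} (hθ0 : θ ≠ 0)
    (hθ : σ θ = -θ) (hcore : ρ (coreE F K) = coreE F K) {φ : (Fin 2 → K) → K10A F K}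
    (hφ : Function.Injective φ) (hadd : ∀ w w', φ (w + w') = φ w + φ w')
    (hsmul : ∀ (c : K) w, φ (c • w) = c • φ w)
    (hmul : ∀ w w', φ w * φ w' = symp w w' • coreE F K) (hmem : ∀ w, ∃ w', φ w' = ρ (φ w)) :
    ∃ w w', ρ (φ w) = φ w ∧ ρ (φ w') = φ w' ∧ symp w w' = 1 := by
  choose f hf using hmem
  obtain ⟨w, w', hw, hw', h⟩ := K10A.exists_fixed_symp_eq_one (σ := σ) h2 hθ0 hθ (f := f)
    (fun w w' => hφ <| by rw [hf, hadd, hadd, hρ.map_add, hf, hf])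
    (fun c w => hφ <| by rw [hf, hsmul, hsmul, hρ.map_smul, hf])
    (fun w => hφ <| by rw [hf, hf, hρ.invol])
    (fun w w' => smul_coreE_injective (F := F) <| by
      rw [← hmul, hf, hf, ← hρ.map_mul, hmul, hρ.map_smul, hcore])
  exact ⟨w, w', by rw [← hf, hw], by rw [← hf, hw'], h⟩

/-- A semilinear involution of `K₁₀ ⊗ K` is conjugate, under the action of `SL₂ × SL₂`, to
`id ⊗ σ` or to `τ ⊗ σ`. -/
theorem exists_slMap (hρ : IsDescentMap σ ρ) (hchar : (2 : F) ≠ 0) {θ : K} (hθ0 : θ ≠ 0)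
    (hθ : σ θ = -θ) :
    (∃ g h : SL2 K, ∀ x, ρ (slMap g h x) = slMap g h (conjFun σ x)) ∨
      ∃ g h : SL2 K, ∀ x, ρ (slMap g h x) = slMap g h (tauSigmaFun σ x) := by
  have h2 : (2 : K) ≠ 0 := by
    rw [← map_ofNat (algebraMap F K) 2]; exact (_root_.map_ne_zero _).mpr hchar
  have hσ4 : σ (4 : K) = 4 := map_ofNat σ 4
  have hL := hρ.map_oddLeft_or (P := oddLeft F K) fun x hx => hρ.map_mem_oddLeft_or hchar (.inl hx)
  have hR := hρ.map_oddLeft_or (P := oddRight F K) fun x hx => hρ.map_mem_oddLeft_or hchar (.inr hx)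
  have hcore := hρ.map_coreE hchar hL
  have haa := hρ.map_aaE hcore
  rcases hL with hL | hL
  · have hR : ∀ x ∈ oddRight F K, ρ x ∈ oddRight F K := hR.resolve_left fun hR => by
      have h := hL _ (hR _ (mem_oddRight.mpr ⟨![1, 0], rfl⟩))
      rw [hρ.invol] at h
      obtain ⟨w, hw⟩ := mem_oddLeft.mp h
      simpa [waE, awE] using congrFun hw 8
    obtain ⟨w, w', hw, hw', hsymp⟩ := hρ.exists_fixed_symp_eq_one h2 hθ0 hθ hcore waE_injective
      waE_add waE_smul waE_mul_waE fun w => mem_oddLeft.mp (hL _ (mem_oddLeft.mpr ⟨w, rfl⟩))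
    obtain ⟨v, v', hv, hv', hsymp'⟩ := hρ.exists_fixed_symp_eq_one h2 hθ0 hθ hcore awE_injective
      awE_add awE_smul awE_mul_awE fun w => mem_oddRight.mp (hR _ (mem_oddRight.mpr ⟨w, rfl⟩))
    obtain ⟨g, hg, hg'⟩ := exists_SL2_of_symp_eq_one hsymp
    obtain ⟨h, hh, hh'⟩ := exists_SL2_of_symp_eq_one hsymp'
    refine .inl ⟨g, h, fun x => ?_⟩
    simp only [slMap_eq hchar, hg, hg', hh, hh', hρ.map_add, hρ.map_smul, hρ.map_mul, hρ.map_oneE,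
      haa, hw, hw', hv, hv', _root_.map_mul, hσ4, conjFun]
  · obtain ⟨v, hv⟩ := mem_oddRight.mp (hL _ (mem_oddLeft.mpr ⟨![1, 0], rfl⟩))
    obtain ⟨v', hv'⟩ := mem_oddRight.mp (hL _ (mem_oddLeft.mpr ⟨![0, 1], rfl⟩))
    have hsymp : symp (![1, 0] : Fin 2 → K) ![0, 1] = 1 := by simp [symp]
    have hsymp' : symp v v' = 1 := smul_coreE_injective (F := F) <| by
      rw [← awE_mul_awE, hv, hv', ← hρ.map_mul, waE_mul_waE, hρ.map_smul, hcore,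
        hsymp, map_one]
    have hw : ρ (awE F K v) = waE F K ![1, 0] := by rw [hv, hρ.invol]
    have hw' : ρ (awE F K v') = waE F K ![0, 1] := by rw [hv', hρ.invol]
    obtain ⟨g, hg, hg'⟩ := exists_SL2_of_symp_eq_one hsymp
    obtain ⟨h, hh, hh'⟩ := exists_SL2_of_symp_eq_one hsymp'
    refine .inr ⟨g, h, fun x => ?_⟩
    simp only [slMap_eq hchar, hg, hg', hh, hh', hρ.map_add, hρ.map_smul, hρ.map_mul, hρ.map_oneE,
      haa, ← hv, ← hv', hw, hw', _root_.map_mul, hσ4, awE_mul_waE, tauSigmaFun]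
    module

end IsDescentMap

/-! ### Twisted forms split by `K` -/

/-- Two graded algebras embedded in `K₁₀ ⊗ K` with the same image are isomorphic. -/
lemma nonempty_superIso_of_range_eq {A C : Type} [NonUnitalNonAssocRing A] [Module F A]
    [NonUnitalNonAssocRing C] [Module F C] {evA odA : Submodule F A} {evC odC : Submodule F C}
    (hA : evA ⊔ odA = ⊤) (j : A →ₗ[F] K10A F K) (i : C →ₗ[F] K10A F K)
    (hj : Function.Injective j) (hi : Function.Injective i)
    (hjmul : ∀ x y, j (x * y) = j x * j y) (himul : ∀ x y, i (x * y) = i x * i y)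
    (hjev : ∀ x ∈ evA, j x ∈ even F K F) (hjod : ∀ x ∈ odA, j x ∈ odd F K F)
    (hiev : ∀ x, i x ∈ even F K F ↔ x ∈ evC) (hiod : ∀ x, i x ∈ odd F K F ↔ x ∈ odC)
    (hrange : LinearMap.range j = LinearMap.range i) :
    Nonempty (SuperIso F A C evA odA evC odC) := by
  let e : A ≃ₗ[F] C := LinearEquiv.ofInjective j hj ≪≫ₗ LinearEquiv.ofEq _ _ hrange ≪≫ₗ
    (LinearEquiv.ofInjective i hi).symm
  have he (a : A) : i (e a) = j a := by
    have := congrArg Subtype.val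
      ((LinearEquiv.ofInjective i hi).apply_symm_apply (LinearEquiv.ofEq _ _ hrange
        (LinearEquiv.ofInjective j hj a)))
    exact this
  have hev (a : A) (ha : a ∈ evA) : e a ∈ evC := (hiev _).mp <| he a ▸ hjev a ha
  have hod (a : A) (ha : a ∈ odA) : e a ∈ odC := (hiod _).mp <| he a ▸ hjod a ha
  have hdisj (c : C) (h0 : c ∈ evC) (h1 : c ∈ odC) : c = 0 := by
    obtain ⟨h6, h7, h8, h9⟩ := mem_even.mp ((hiev c).mpr h0)
    obtain ⟨h0, h1, h2, h3, h4, h5⟩ := mem_odd.mp ((hiod c).mpr h1)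
    apply hi
    rw [map_zero]
    funext k
    fin_cases k <;> assumption
  have hdecomp (a : A) : ∃ a₀ ∈ evA, ∃ a₁ ∈ odA, a₀ + a₁ = a :=
    Submodule.mem_sup.mp (hA ▸ Submodule.mem_top)
  refine ⟨⟨e, fun x y => hi ?_, ?_, ?_⟩⟩
  · rw [himul, he, he, he, hjmul]
  · refine le_antisymm (Submodule.map_le_iff_le_comap.mpr hev) fun c hc => ?_
    obtain ⟨a₀, h₀, a₁, h₁, h⟩ := hdecomp (e.symm c)
    have hc' : c = e a₀ + e a₁ := by rw [← map_add, h, e.apply_symm_apply]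
    have h0 := hdisj _ ((Submodule.add_mem_iff_right _ (hev _ h₀)).mp (hc' ▸ hc)) (hod _ h₁)
    exact ⟨a₀, h₀, by rw [hc', h0, add_zero]; rfl⟩
  · refine le_antisymm (Submodule.map_le_iff_le_comap.mpr hod) fun c hc => ?_
    obtain ⟨a₀, h₀, a₁, h₁, h⟩ := hdecomp (e.symm c)
    have hc' : c = e a₀ + e a₁ := by rw [← map_add, h, e.apply_symm_apply]
    have h0 := hdisj _ (hev _ h₀) ((Submodule.add_mem_iff_left _ (hod _ h₁)).mp (hc' ▸ hc))
    exact ⟨a₁, h₁, by rw [hc', h0, zero_add]; rfl⟩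

/-- The coordinatewise inclusion of `K₁₀` in `K₁₀ ⊗ K`. -/
def extendScalars : K10A F F →ₗ[F] K10A F K where
  toFun x i := algebraMap F K (x i)
  map_add' x y := by funext i; exact map_add (algebraMap F K) (x i) (y i)
  map_smul' c x := by
    funext i; exact (map_mul (algebraMap F K) c (x i)).trans (Algebra.smul_def c _).symm

lemma extendScalars_apply (x : K10A F F) (i : Fin 10) :
    extendScalars (K := K) x i = algebraMap F K (x i) := rfl

lemma extendScalars_mul (x y : K10A F F) :
    extendScalars (K := K) (x * y) = extendScalars x * extendScalars y := by
  funext i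
  fin_cases i <;>
    simp only [extendScalars_apply, mul_def, mulFun, map_add, map_sub, map_mul,
      Algebra.algebraMap_self_apply]

section Twist

variable {A : Type} [NonUnitalNonAssocRing A] [Module F A]

lemma rTensor_smul (σ : K ≃ₐ[F] K) (c : K) (x : K ⊗[F] A) :
    σ.toLinearMap.rTensor A (c • x) = σ c • σ.toLinearMap.rTensor A x := by
  induction x with
  | zero => simp
  | add x y hx hy => rw [smul_add, map_add, hx, hy, map_add, smul_add]
  | tmul k a => simp [TensorProduct.smul_tmul']

lemma rTensor_mem_baseChange (σ : K ≃ₐ[F] K) {P : Submodule F A} {x : K ⊗[F] A}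
    (hx : x ∈ P.baseChange K) : σ.toLinearMap.rTensor A x ∈ P.baseChange K := by
  rw [Submodule.baseChange_eq_span] at hx
  induction hx using Submodule.span_induction with
  | mem x h =>
    obtain ⟨a, ha, rfl⟩ := h
    simpa using Submodule.tmul_mem_baseChange_of_mem _ ha
  | zero => simp
  | add x y _ _ hx hy => rw [map_add]; exact add_mem hx hy
  | smul c x _ hx => rw [rTensor_smul]; exact Submodule.smul_mem _ _ hx

lemma rTensor_rTensor {σ : K ≃ₐ[F] K} (hσ : ∀ k, σ (σ k) = k) (x : K ⊗[F] A) :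
    σ.toLinearMap.rTensor A (σ.toLinearMap.rTensor A x) = x := by
  induction x with
  | zero => simp
  | add x y hx hy => rw [map_add, map_add, hx, hy]
  | tmul k a => simp [hσ]

lemma exists_one_tmul_eq_add {σ : K ≃ₐ[F] K} (hσ : ∀ k, σ (σ k) = k)
    (hfix : ∀ k, σ k = k → k ∈ Set.range (algebraMap F K)) (x : K ⊗[F] A) :
    ∃ a : A, x + σ.toLinearMap.rTensor A x = 1 ⊗ₜ a := by
  induction x with
  | zero => exact ⟨0, by simp⟩
  | add x y hx hy =>
    obtain ⟨a, ha⟩ := hx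
    obtain ⟨b, hb⟩ := hy
    exact ⟨a + b, by rw [map_add, add_add_add_comm, ha, hb, TensorProduct.tmul_add]⟩
  | tmul k a =>
    obtain ⟨c, hc⟩ := hfix (k + σ k) (by rw [map_add, hσ, add_comm])
    refine ⟨c • a, ?_⟩
    rw [← TensorProduct.smul_tmul, ← Algebra.algebraMap_eq_smul_one, hc, TensorProduct.add_tmul]
    simp

variable [SMulCommClass F A A] [IsScalarTower F A A]

lemma rTensor_mul (σ : K ≃ₐ[F] K) (x y : K ⊗[F] A) :
    σ.toLinearMap.rTensor A (x * y) = σ.toLinearMap.rTensor A x * σ.toLinearMap.rTensor A y := by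
  induction x with
  | zero => simp
  | add x x' hx hx' => rw [add_mul, map_add, hx, hx', map_add, add_mul]
  | tmul k a =>
    induction y with
    | zero => simp
    | add y y' hy hy' => rw [mul_add, map_add, hy, hy', map_add, mul_add]
    | tmul l b => simp [Algebra.TensorProduct.tmul_mul_tmul]

variable {evA odA : Submodule F A} (e : SuperIso K (K ⊗[F] A) (K10A F K)
  (evA.baseChange K) (odA.baseChange K) (even F K K) (odd F K K)) (σ : K ≃ₐ[F] K)

/-- The semilinear involution of `K₁₀ ⊗ K` transported from `σ ⊗ id` on `K ⊗ A`. -/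
def descentMap (x : K10A F K) : K10A F K := e.e (σ.toLinearMap.rTensor A (e.e.symm x))

/-- The embedding of `A` in `K₁₀ ⊗ K` given by a splitting over `K`. -/
def splitEmbedding : A →ₗ[F] K10A F K :=
  e.e.toLinearMap.restrictScalars F ∘ₗ TensorProduct.mk F K A 1

variable {σ}

lemma isDescentMap (hσ : ∀ k, σ (σ k) = k) : IsDescentMap σ (descentMap e σ) where
  map_add x y := by simp only [descentMap, map_add]
  map_smul c x := by simp only [descentMap, map_smul, rTensor_smul]
  map_mul x y := by
    have h : e.e.symm (x * y) = e.e.symm x * e.e.symm y := e.e.injective <| by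
      simp only [e.map_mul', LinearEquiv.apply_symm_apply]
    rw [descentMap, h, rTensor_mul, e.map_mul']
    rfl
  map_odd x hx := by
    rw [← e.map_odd] at hx ⊢
    obtain ⟨t, ht, rfl⟩ := hx
    exact ⟨_, rTensor_mem_baseChange σ ht, by simp [descentMap]⟩
  invol x := by simp only [descentMap, LinearEquiv.symm_apply_apply, rTensor_rTensor hσ,
    LinearEquiv.apply_symm_apply]

lemma mem_range_splitEmbedding (h2 : (2 : F) ≠ 0) (hσ : ∀ k, σ (σ k) = k)
    (hfix : ∀ k, σ k = k → k ∈ Set.range (algebraMap F K)) {x : K10A F K} :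
    x ∈ LinearMap.range (splitEmbedding e) ↔ descentMap e σ x = x := by
  constructor
  · rintro ⟨a, rfl⟩
    simp [splitEmbedding, descentMap]
  · intro h
    obtain ⟨a, ha⟩ := exists_one_tmul_eq_add hσ hfix (e.e.symm x)
    have h' : σ.toLinearMap.rTensor A (e.e.symm x) = e.e.symm x := e.e.injective <| by
      rw [LinearEquiv.apply_symm_apply]; exact h
    rw [h', ← two_smul F] at ha
    refine ⟨(2⁻¹ : F) • a, ?_⟩
    have : e.e.symm x = (2⁻¹ : F) • (1 ⊗ₜ a) := by
      rw [← ha, smul_smul, inv_mul_cancel₀ h2, one_smul]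
    rw [← e.e.apply_symm_apply x, this, ← TensorProduct.tmul_smul]
    rfl

lemma splitEmbedding_injective : Function.Injective (splitEmbedding e) :=
  e.e.injective.comp (Module.FaithfullyFlat.tensorProduct_mk_injective A)

lemma splitEmbedding_mul (x y : A) :
    splitEmbedding e (x * y) = splitEmbedding e x * splitEmbedding e y := by
  simp only [splitEmbedding, LinearMap.comp_apply, LinearMap.restrictScalars_apply,
    TensorProduct.mk_apply, LinearEquiv.coe_coe, ← e.map_mul', Algebra.TensorProduct.tmul_mul_tmul,
    one_mul]

lemma splitEmbedding_mem_even {x : A} (hx : x ∈ evA) : splitEmbedding e x ∈ even F K F := by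
  have h : splitEmbedding e x ∈ even F K K := by
    rw [← e.map_even]
    exact ⟨_, Submodule.tmul_mem_baseChange_of_mem 1 hx, rfl⟩
  exact h

lemma splitEmbedding_mem_odd {x : A} (hx : x ∈ odA) : splitEmbedding e x ∈ odd F K F := by
  have h : splitEmbedding e x ∈ odd F K K := by
    rw [← e.map_odd]
    exact ⟨_, Submodule.tmul_mem_baseChange_of_mem 1 hx, rfl⟩
  exact h

end Twist

end Descent

end K10A
end Kac

/-! ### STATEMENT 9 -/

set_option synthInstance.maxHeartbeats 1000000 in
set_option maxHeartbeats 1000000 in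
open Kac K10A in
/-- Let `K/F` be a quadratic separable field extension with Galois group
`{id, σ}`, and let `K₁₀,K = {X ∈ K₁₀ ⊗_F K : (τ⊗σ)(X) = X}` (realized as
`fixedK10 σ` inside `K10A F K`).  If `A` is a twisted form of `K₁₀` over `F`
which is not isomorphic to `K₁₀` and with `A ⊗_F K ≅ K₁₀ ⊗_F K` as
`K`-superalgebras, then `A ≅ K₁₀,K` as `F`-superalgebras. -/
theorem twisted_form_split_by_K_is_fixed_points (F : Type) [Field F] (hchar : (2 : F) ≠ 0)
    (K : Type) [Field K] [Algebra F K] (hquad : Module.finrank F K = 2)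
    [Algebra.IsSeparable F K] (σ : K ≃ₐ[F] K) (hσ : σ ≠ (AlgEquiv.refl : K ≃ₐ[F] K))
    (hGal : ∀ τ : K ≃ₐ[F] K, τ = (AlgEquiv.refl : K ≃ₐ[F] K) ∨ τ = σ)
    (A : Type) [NonUnitalNonAssocRing A] [Module F A]
    [SMulCommClass F A A] [IsScalarTower F A A] [FiniteDimensional F A]
    (evA odA : Submodule F A) (hsuper : IsSuperalgebra F A evA odA)
    (htwist : Nonempty (SuperIso (AlgebraicClosure F)
      ((AlgebraicClosure F) ⊗[F] A) (K10A F (AlgebraicClosure F))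
      (evA.baseChange (AlgebraicClosure F)) (odA.baseChange (AlgebraicClosure F))
      (even F (AlgebraicClosure F) (AlgebraicClosure F))
      (odd F (AlgebraicClosure F) (AlgebraicClosure F))))
    (hnontrivial : ¬ Nonempty (SuperIso F A (K10A F F) evA odA
      (even F F F) (odd F F F)))
    (hsplit : Nonempty (SuperIso K (K ⊗[F] A) (K10A F K)
      (evA.baseChange K) (odA.baseChange K) (even F K K) (odd F K K))) :
    Nonempty (SuperIso F A (↥(fixedK10 σ)) evA odA (fixedEven σ) (fixedOdd σ)) := by
  obtain ⟨e⟩ := hsplit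
  have : Algebra.IsQuadraticExtension F K := ⟨hquad⟩
  have hσσ (k : K) : σ (σ k) = k := by
    rcases hGal (σ * σ) with h | h
    · exact DFunLike.congr_fun h k
    · exact absurd (mul_eq_right.mp h) hσ
  have hfix (k : K) (hk : σ k = k) : k ∈ Set.range (algebraMap F K) := by
    rw [IsGalois.mem_range_algebraMap_iff_fixed]
    intro τ
    rcases hGal τ with rfl | rfl
    · rfl
    · exact hk
  obtain ⟨k, hk⟩ : ∃ k, σ k ≠ k := by
    by_contra! h
    exact hσ (AlgEquiv.ext h)
  have hρ := isDescentMap e hσσ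
  have hrange {x : K10A F K} := mem_range_splitEmbedding (x := x) e hchar hσσ hfix
  rcases hρ.exists_slMap hchar (θ := k - σ k) (sub_ne_zero.mpr hk.symm)
    (by rw [map_sub, hσσ, neg_sub]) with ⟨g, h, hgh⟩ | ⟨g, h, hgh⟩
  · refine absurd ?_ hnontrivial
    have hinj := (algebraMap F K).injective
    refine nonempty_superIso_of_range_eq hsuper.1 (splitEmbedding e)
      ((slMap g h).restrictScalars F ∘ₗ extendScalars) (splitEmbedding_injective e)
      ((slMap_bijective g h).1.comp fun x y hxy => ?_)
      (splitEmbedding_mul e) (fun x y => ?_) (fun _ => splitEmbedding_mem_even e)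
      (fun _ => splitEmbedding_mem_odd e) (fun x => ⟨fun hx => ?_, fun hx => ?_⟩)
      (fun x => ⟨fun hx => ?_, fun hx => ?_⟩) ?_
    · funext i
      exact hinj (congrFun hxy i)
    · simp only [LinearMap.comp_apply, LinearMap.restrictScalars_apply, extendScalars_mul,
        slMap_mul]
    · have := mem_even.mp (mem_even_of_slMap_mem_even g h hx)
      simpa only [mem_even, extendScalars_apply, map_eq_zero] using this
    · refine slMap_mem_even g h ?_
      simpa only [mem_even, extendScalars_apply, map_eq_zero] using hx
    · have := mem_odd.mp (mem_odd_of_slMap_mem_odd g h hx)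
      simpa only [mem_odd, extendScalars_apply, map_eq_zero] using this
    · refine slMap_mem_odd g h ?_
      simpa only [mem_odd, extendScalars_apply, map_eq_zero] using hx
    · ext x
      obtain ⟨y, rfl⟩ := (slMap_bijective g h).2 x
      rw [hrange, hgh, (slMap_bijective g h).1.eq_iff]
      constructor
      · intro hy
        choose z hz using fun i => hfix (y i) (congrFun hy i)
        exact ⟨z, congrArg (slMap g h) (funext hz)⟩
      · rintro ⟨z, hz⟩
        rw [← (slMap_bijective g h).1 hz]
        funext i
        exact σ.commutes (z i)
  · refine nonempty_superIso_of_range_eq hsuper.1 (splitEmbedding e)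
      ((slMap g h).restrictScalars F ∘ₗ (fixedK10 σ).subtype) (splitEmbedding_injective e)
      ((slMap_bijective g h).1.comp Subtype.val_injective)
      (splitEmbedding_mul e) (fun x y => slMap_mul g h _ _) (fun _ => splitEmbedding_mem_even e)
      (fun _ => splitEmbedding_mem_odd e)
      (fun x => ⟨mem_even_of_slMap_mem_even g h, slMap_mem_even g h⟩)
      (fun x => ⟨mem_odd_of_slMap_mem_odd g h, slMap_mem_odd g h⟩) ?_
    ext x
    obtain ⟨y, rfl⟩ := (slMap_bijective g h).2 x
    rw [hrange, hgh, (slMap_bijective g h).1.eq_iff, ← mem_fixedK10]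
    constructor
    · exact fun hy => ⟨⟨y, hy⟩, rfl⟩
    · rintro ⟨z, hz⟩
      exact (slMap_bijective g h).1 hz ▸ z.2
end
end

section
/- The superalgebra K₃ is rigid: every twisted form of K₃ over F is isomorphic to K₃ as an F-superalgebra. -/
open scoped TensorProduct
noncomputable section
namespace Kac

/-- `p` (a submodule of `B`, e.g. the even part) is isomorphic, as an
`F`-algebra, to `C`: there is an `F`-linear bijection preserving products. -/
def SubAlgIso (F B C : Type) [Field F] [NonUnitalNonAssocRing B] [Module F B]
    [Ring C] [Algebra F C] (p : Submodule F B) : Prop :=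
  ∃ e : p ≃ₗ[F] C, ∀ (x y : p) (h : (x : B) * (y : B) ∈ p),
    e ⟨(x : B) * (y : B), h⟩ = e x * e y

/-- A quadratic étale `F`-algebra: two-dimensional, and either isomorphic to
`F × F` or a (quadratic) separable field extension of `F`. -/
def IsQuadraticEtale (F K : Type) [Field F] [CommRing K] [Algebra F K] : Prop :=
  Module.finrank F K = 2 ∧
    (Nonempty (K ≃ₐ[F] (F × F)) ∨ (IsField K ∧ Algebra.IsSeparable F K))

end Kac

/-! ### STATEMENT 10 -/

namespace Kac

namespace K3A

variable {F : Type} [Field F] {R : Type} [CommRing R] [Algebra F R]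

lemma mul_apply_zero (x y : K3A F R) : (x * y) 0 = x 0 * y 0 + (x 1 * y 2 - x 2 * y 1) := rfl

lemma mul_apply_one (x y : K3A F R) :
    (x * y) 1 = algebraMap F R 2⁻¹ * (x 0 * y 1 + y 0 * x 1) := rfl

lemma mul_apply_two (x y : K3A F R) :
    (x * y) 2 = algebraMap F R 2⁻¹ * (x 0 * y 2 + y 0 * x 2) := rfl

lemma ext_coords {x y : K3A F R} (h0 : x 0 = y 0) (h1 : x 1 = y 1) (h2 : x 2 = y 2) : x = y := by
  funext i
  fin_cases i
  exacts [h0, h1, h2]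

variable (S : Type) [Semiring S] [Module S R]

lemma mem_even {x : K3A F R} : x ∈ even F R S ↔ x 1 = 0 ∧ x 2 = 0 := by
  change (∀ i : Fin 3, i ∉ ({0} : Set (Fin 3)) → x i = 0) ↔ _
  simp [Fin.forall_fin_succ]

lemma mem_odd {x : K3A F R} : x ∈ odd F R S ↔ x 0 = 0 := by
  change (∀ i : Fin 3, i ∉ ({1, 2} : Set (Fin 3)) → x i = 0) ↔ _
  simp [Fin.forall_fin_succ]

lemma finrank_eq_three (L : Type) [Field L] [Algebra F L] : Module.finrank L (K3A F L) = 3 :=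
  Module.finrank_fin_fun L

lemma finrank_even (L : Type) [Field L] [Algebra F L] :
    Module.finrank L (even F L L) = 1 := by
  have h : even F L L = Submodule.span L {aE F L} := by
    ext x
    rw [mem_even, Submodule.mem_span_singleton]
    constructor
    · rintro ⟨h1, h2⟩
      exact ⟨x 0, ext_coords (mul_one _) ((mul_zero _).trans h1.symm)
        ((mul_zero _).trans h2.symm)⟩
    · rintro ⟨c, rfl⟩
      exact ⟨mul_zero c, mul_zero c⟩
  rw [h]
  refine finrank_span_singleton fun h0 => one_ne_zero (α := L) ?_
  exact congrFun h0 0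

end K3A

/-- The linear map from `K₃` sending the standard basis to `e, v, w`. -/
def K3A.lift {F B : Type} [Field F] [AddCommGroup B] [Module F B] (e v w : B) :
    K3A F F →ₗ[F] B where
  toFun x := x 0 • e + x 1 • v + x 2 • w
  map_add' x y := by simp only [K3A.add_apply]; module
  map_smul' c x := by simp only [K3A.smul_apply, smul_eq_mul, RingHom.id_apply]; module

lemma K3A.lift_apply {F B : Type} [Field F] [AddCommGroup B] [Module F B] (e v w : B)
    (x : K3A F F) : K3A.lift e v w x = x 0 • e + x 1 • v + x 2 • w := rfl

section Embedding

variable {F : Type} [Field F] {L : Type} [Field L] [Algebra F L]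
  {B : Type} [NonUnitalNonAssocRing B] [Module F B] {evB odB : Submodule F B}

/-- A superalgebra of dimension 3 with one-dimensional even part and nonzero product of odd
elements which embeds in `K₃ ⊗ L` is isomorphic to `K₃`. -/
theorem nonempty_superIso_K3A_of_embedding
    (hsuper : IsSuperalgebra F B evB odB)
    (hB : Module.finrank F B = 3) (hev : Module.finrank F evB = 1)
    (f : B → K3A F L) (hadd : ∀ x y, f (x + y) = f x + f y)
    (hsmul : ∀ (c : F) x, f (c • x) = algebraMap F L c • f x)
    (hmul : ∀ x y, f (x * y) = f x * f y) (hinj : Function.Injective f)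
    (hfe : ∀ x ∈ evB, f x ∈ K3A.even F L L) (hfo : ∀ x ∈ odB, f x ∈ K3A.odd F L L)
    (hodd : ∃ v ∈ odB, ∃ w ∈ odB, v * w ≠ 0) :
    Nonempty (SuperIso F B (K3A F F) evB odB (K3A.even F F F) (K3A.odd F F F)) := by
  obtain ⟨-, -, hee, -, -, hoo⟩ := hsuper
  have hf0 : f 0 = 0 := by simpa using hadd 0 0
  obtain ⟨v', hv', w, hw, hvw⟩ := hodd
  obtain ⟨μ, e, he, hfe0, hμ⟩ : ∃ μ : F, ∃ e ∈ evB, f e 0 = 1 ∧ v' * w = μ • e := by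
    have hmem := hoo _ hv' _ hw
    have key := (finrank_eq_one_iff_of_nonzero' (⟨v' * w, hmem⟩ : evB)
      (by simpa [Subtype.ext_iff] using hvw)).1 hev
    obtain ⟨c, hc⟩ := key ⟨(v' * w) * (v' * w), hee _ hmem _ hmem⟩
    have hc : c • (v' * w) = (v' * w) * (v' * w) := congrArg Subtype.val hc
    obtain ⟨h1, h2⟩ := (K3A.mem_even L).1 (hfe _ hmem)
    have h0 : f (v' * w) 0 ≠ 0 := fun h0 => hvw <| hinj <| by
      rw [hf0]; exact K3A.ext_coords h0 h1 h2
    have h3 := congrFun (congrArg f hc) 0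
    rw [hsmul, hmul (v' * w), K3A.mul_apply_zero, h1, h2, K3A.smul_apply, smul_eq_mul] at h3
    have h4 : f (v' * w) 0 = algebraMap F L c := by
      apply mul_right_cancel₀ h0
      linear_combination -h3
    have hc0 : c ≠ 0 := by
      rintro rfl
      exact h0 (by simpa using h4)
    refine ⟨c, c⁻¹ • (v' * w), evB.smul_mem _ hmem, ?_, by rw [smul_inv_smul₀ hc0]⟩
    rw [hsmul, K3A.smul_apply, h4, smul_eq_mul, ← map_mul, inv_mul_cancel₀ hc0, map_one]
  have hμ0 : μ ≠ 0 := by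
    rintro rfl
    exact hvw (by simpa using hμ)
  have hw0 := (K3A.mem_odd L).1 (hfo _ hw)
  obtain ⟨v, hv, hdet⟩ : ∃ v ∈ odB, f v 1 * f w 2 - f v 2 * f w 1 = 1 := by
    refine ⟨μ⁻¹ • v', odB.smul_mem _ hv', ?_⟩
    have h := congrFun (congrArg f hμ) 0
    rw [hmul, hsmul, K3A.mul_apply_zero, hw0, K3A.smul_apply, hfe0, smul_eq_mul] at h
    have hm : algebraMap F L μ⁻¹ * algebraMap F L μ = 1 := by
      rw [← map_mul, inv_mul_cancel₀ hμ0, map_one]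
    simp only [hsmul, K3A.smul_apply, smul_eq_mul]
    linear_combination algebraMap F L μ⁻¹ * h + hm
  obtain ⟨he1, he2⟩ := (K3A.mem_even L).1 (hfe _ he)
  have hv0 := (K3A.mem_odd L).1 (hfo _ hv)
  let g : K3A F F →ₗ[F] B := K3A.lift e v w
  have hg : ∀ x, f (g x) = algebraMap F L (x 0) • f e + algebraMap F L (x 1) • f v
      + algebraMap F L (x 2) • f w := fun x => by
    rw [K3A.lift_apply, hadd, hadd, hsmul, hsmul, hsmul]
  have hg0 : ∀ x, f (g x) 0 = algebraMap F L (x 0) := fun x => by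
    simp [hg, hfe0, hv0, hw0]
  have hg1 : ∀ x, f (g x) 1 = algebraMap F L (x 1) * f v 1 + algebraMap F L (x 2) * f w 1 :=
    fun x => by simp [hg, he1]
  have hg2 : ∀ x, f (g x) 2 = algebraMap F L (x 1) * f v 2 + algebraMap F L (x 2) * f w 2 :=
    fun x => by simp [hg, he2]
  have hodd_zero : ∀ x, f (g x) 1 = 0 → f (g x) 2 = 0 → x 1 = 0 ∧ x 2 = 0 := fun x h1 h2 => by
    rw [hg1] at h1
    rw [hg2] at h2
    constructor <;> apply (algebraMap F L).injective <;> rw [map_zero]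
    · linear_combination f w 2 * h1 - f w 1 * h2 - algebraMap F L (x 1) * hdet
    · linear_combination f v 1 * h2 - f v 2 * h1 - algebraMap F L (x 2) * hdet
  have hginj : Function.Injective g := by
    rw [injective_iff_map_eq_zero]
    intro x hx
    have hfx : f (g x) = 0 := by rw [hx, hf0]
    obtain ⟨h1, h2⟩ := hodd_zero x (congrFun hfx 1) (congrFun hfx 2)
    refine K3A.ext_coords ((algebraMap F L).injective ?_) h1 h2
    rw [← hg0, hfx]
    simp
  have : FiniteDimensional F B := Module.finite_of_finrank_pos (by omega)
  have : FiniteDimensional F (K3A F F) :=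
    Module.finite_of_finrank_pos (by rw [K3A.finrank_eq_three]; omega)
  let G : K3A F F ≃ₗ[F] B :=
    LinearEquiv.ofInjectiveOfFinrankEq g hginj (by rw [K3A.finrank_eq_three, hB])
  have hG : ∀ x, G x = g x := fun _ => rfl
  have hGmul : ∀ x y, G (x * y) = G x * G y := fun x y => by
    apply hinj
    simp only [hG, hmul]
    refine K3A.ext_coords ?_ ?_ ?_ <;>
      simp only [K3A.mul_apply_zero, K3A.mul_apply_one, K3A.mul_apply_two, hg0, hg1, hg2,
        map_add, map_sub, map_mul, Algebra.algebraMap_self, RingHom.id_apply]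
    · linear_combination -(algebraMap F L (x 1) * algebraMap F L (y 2)
        - algebraMap F L (x 2) * algebraMap F L (y 1)) * hdet
    · ring
    · ring
  have hGsymm : ∀ y, f (g (G.symm y)) = f y := fun y => by rw [← hG, G.apply_symm_apply]
  refine ⟨⟨G.symm, fun x y => ?_, ?_, ?_⟩⟩
  · apply G.injective
    simp [hGmul]
  · ext x
    rw [Submodule.mem_map_equiv, LinearEquiv.symm_symm, K3A.mem_even, hG]
    constructor
    · intro hx
      obtain ⟨h1, h2⟩ := (K3A.mem_even L).1 (hfe _ hx)
      exact hodd_zero x h1 h2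
    · rintro ⟨h1, h2⟩
      rw [K3A.lift_apply, h1, h2]
      simpa using evB.smul_mem _ he
  · ext x
    rw [Submodule.mem_map_equiv, LinearEquiv.symm_symm, K3A.mem_odd, hG]
    constructor
    · intro hx
      apply (algebraMap F L).injective
      rw [← hg0, (K3A.mem_odd L).1 (hfo _ hx), map_zero]
    · intro h0
      rw [K3A.lift_apply, h0, zero_smul, zero_add]
      exact odB.add_mem (odB.smul_mem _ hv) (odB.smul_mem _ hw)

end Embedding

/-- If all products of elements of `p` vanish, so do all products of elements of its
base change. -/
lemma mul_eq_zero_of_mem_baseChange {F L B : Type} [Field F] [Field L] [Algebra F L]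
    [NonUnitalNonAssocRing B] [Module F B] [SMulCommClass F B B] [IsScalarTower F B B]
    {p : Submodule F B} (hp : ∀ v ∈ p, ∀ w ∈ p, v * w = 0) {x y : L ⊗[F] B}
    (hx : x ∈ p.baseChange L) (hy : y ∈ p.baseChange L) : x * y = 0 := by
  rw [Submodule.baseChange_eq_span] at hx hy
  induction hx, hy using Submodule.span_induction₂ with
  | mem_mem x y hx hy =>
    obtain ⟨v, hv, rfl⟩ := hx
    obtain ⟨w, hw, rfl⟩ := hy
    simp [hp v hv w hw]
  | zero_left y hy => exact zero_mul y
  | zero_right x hx => exact mul_zero x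
  | add_left x y z _ _ _ h1 h2 => rw [add_mul, h1, h2, add_zero]
  | add_right x y z _ _ _ h1 h2 => rw [mul_add, h1, h2, add_zero]
  | smul_left r x y _ _ h => rw [smul_mul_assoc, h, smul_zero]
  | smul_right r x y _ _ h => rw [mul_smul_comm, h, smul_zero]

end Kac

open Kac in
/-- `K₃` is rigid: every twisted form of `K₃` over `F` (a finite-dimensional
`F`-superalgebra `B` with `B ⊗_F F̄ ≅ K₃ ⊗_F F̄` as `F̄`-superalgebras) is
isomorphic to `K₃` as an `F`-superalgebra.  Here `K₃ ⊗_F F̄` is realized as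
`K3A F F̄` and `K₃` as `K3A F F`. -/
theorem K3_rigid (F : Type) [Field F] (hchar : (2 : F) ≠ 0)
    (B : Type) [NonUnitalNonAssocRing B] [Module F B]
    [SMulCommClass F B B] [IsScalarTower F B B] [FiniteDimensional F B]
    (evB odB : Submodule F B) (hsuper : IsSuperalgebra F B evB odB)
    (htwist : Nonempty (SuperIso (AlgebraicClosure F)
      ((AlgebraicClosure F) ⊗[F] B) (K3A F (AlgebraicClosure F))
      (evB.baseChange (AlgebraicClosure F)) (odB.baseChange (AlgebraicClosure F))
      (K3A.even F (AlgebraicClosure F) (AlgebraicClosure F))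
      (K3A.odd F (AlgebraicClosure F) (AlgebraicClosure F)))) :
    Nonempty (SuperIso F B (K3A F F) evB odB (K3A.even F F F) (K3A.odd F F F)) := by
  obtain ⟨φ, hmul, hφe, hφo⟩ := htwist
  have hB : Module.finrank F B = 3 := by
    rw [← K3A.finrank_eq_three (F := F) (AlgebraicClosure F), ← φ.finrank_eq,
      Module.finrank_baseChange]
  have hev : Module.finrank F evB = 1 := by
    rw [← K3A.finrank_even (F := F) (AlgebraicClosure F), ← hφe,
      ← Module.finrank_baseChange (R := AlgebraicClosure F),
      (Submodule.toBaseChange.toLinearEquiv (AlgebraicClosure F) evB).finrank_eq]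
    exact (LinearEquiv.finrank_map_eq φ _).symm
  refine nonempty_superIso_K3A_of_embedding hsuper hB hev (fun x => φ (1 ⊗ₜ x))
    (fun x y => by rw [TensorProduct.tmul_add, map_add]) (fun c x => ?_)
    (fun x y => by rw [← hmul, Algebra.TensorProduct.tmul_mul_tmul, one_mul]) ?_
    (fun x hx => ?_) (fun x hx => ?_) ?_
  · rw [← map_smul, TensorProduct.smul_tmul', TensorProduct.tmul_smul, TensorProduct.smul_tmul',
      smul_eq_mul, mul_one, Algebra.smul_def, mul_one]
  · exact φ.injective.comp
      (Module.FaithfullyFlat.tensorProduct_mk_injective (A := F) (B := AlgebraicClosure F) B)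
  · rw [← hφe]
    exact ⟨_, Submodule.tmul_mem_baseChange_of_mem _ hx, rfl⟩
  · rw [← hφo]
    exact ⟨_, Submodule.tmul_mem_baseChange_of_mem _ hx, rfl⟩
  · by_contra! hzero
    have hmem : ∀ w, K3A.wE F (AlgebraicClosure F) w ∈
        (odB.baseChange (AlgebraicClosure F)).map φ.toLinearMap := fun w => by
      rw [hφo, K3A.mem_odd]
      rfl
    obtain ⟨x, hx, hxu⟩ := hmem ![1, 0]
    obtain ⟨y, hy, hyv⟩ := hmem ![0, 1]
    have h := hmul x y
    rw [mul_eq_zero_of_mem_baseChange hzero hx hy, map_zero] at h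
    change φ x = _ at hxu
    change φ y = _ at hyv
    rw [hxu, hyv] at h
    have h0 : (0 : AlgebraicClosure F) = 0 * 0 + (1 * 1 - 0 * 0) := congrFun h 0
    simp at h0
end
end
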